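/- arXiv:1606.01457 — 7 statements merged into one kernel-verified Lean document; each statement's English description precedes it below -/
import Mathlib

section
/- Let N and G be finite nonempty sets, let k ≥ 1 be an integer, and let 𝓑 be the set of k-bundles. Let c : N → 𝓑 → ℝ be rewards and let s̃, s : G → ℝ be supplies with s̃_j ≤ s_j for all j ∈ G. Let x* be an optimal solution of (LIP) with rewards c and supplies s̃. Let x̄ : N → 𝓑 → ℝ with x̄ ≥ 0 satisfy: (i) x̄_i(B) = 0 for every (i,B) with x*_i(B) = 0; (ii) Σ_{B∈𝓑} x̄_i(B) = 1 for every i with Σ_{B∈𝓑} x*_i(B) = 1; (iii) Σ_{B∈𝓑} x̄_i(B) ≤ 1 for every i ∈ N; (iv) Σ_{i∈N} Σ_{B∈𝓑} B_j x̄_i(B) ≤ s_j + k − 1 for every j ∈ G. Define s̄ : G → ℝ by s̄_j = s̃_j if both Σ_{i,B} B_j x*_i(B) < s̃_j and Σ_{i,B} B_j x̄_i(B) ≤ s̃_j, and s̄_j = Σ_{i,B} B_j x̄_i(B) otherwise. Then: (a) s̄_j ≤ s_j + k − 1 for all j ∈ G; (b) x̄ is an optimal solution of (LIP) with rewards c and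 supplies s̄; and (c) every optimal solution (α*, p*) of the dual of (LIP) with rewards c and supplies s̃ is an optimal solution of the dual of (LIP) with rewards c and supplies s̄. -/
/-- The finite set of `k`-bundles: functions `B : G → ℕ` with `B ≠ 0` and `∑ j, B j ≤ k`. -/
noncomputable def kBundles (G : Type*) [Fintype G] (k : ℕ) : Finset (G → ℕ) :=
  letI := Classical.decEq G
  @Finset.filter _ (fun B => B ≠ 0 ∧ ∑ j, B j ≤ k) (Classical.decPred _)
    (Fintype.piFinset fun _ : G => Finset.range (k + 1))

/-- Feasibility for the linear program (LIP) with supplies `s`. -/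
def LIPFeasible {N G : Type*} [Fintype N] [Fintype G] (k : ℕ)
    (s : G → ℝ) (x : N → (G → ℕ) → ℝ) : Prop :=
  (∀ i, ∀ B ∈ kBundles G k, 0 ≤ x i B) ∧
  (∀ i, ∑ B ∈ kBundles G k, x i B ≤ 1) ∧
  (∀ j, ∑ i, ∑ B ∈ kBundles G k, (B j : ℝ) * x i B ≤ s j)

/-- Optimality for the linear program (LIP) with rewards `c` and supplies `s`. -/
def LIPOptimal {N G : Type*} [Fintype N] [Fintype G] (k : ℕ)
    (c : N → (G → ℕ) → ℝ) (s : G → ℝ) (x : N → (G → ℕ) → ℝ) : Prop :=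
  LIPFeasible k s x ∧
  ∀ y : N → (G → ℕ) → ℝ, LIPFeasible k s y →
    ∑ i, ∑ B ∈ kBundles G k, c i B * y i B ≤ ∑ i, ∑ B ∈ kBundles G k, c i B * x i B

/-- Feasibility for the dual of (LIP) with rewards `c`. -/
def DualFeasible {N G : Type*} [Fintype N] [Fintype G] (k : ℕ)
    (c : N → (G → ℕ) → ℝ) (α : N → ℝ) (p : G → ℝ) : Prop :=
  (∀ i, 0 ≤ α i) ∧ (∀ j, 0 ≤ p j) ∧
  ∀ i, ∀ B ∈ kBundles G k, c i B ≤ α i + ∑ j, (B j : ℝ) * p j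

/-- Optimality for the dual of (LIP) with rewards `c` and supplies `s`. -/
def DualOptimal {N G : Type*} [Fintype N] [Fintype G] (k : ℕ)
    (c : N → (G → ℕ) → ℝ) (s : G → ℝ) (α : N → ℝ) (p : G → ℝ) : Prop :=
  DualFeasible k c α p ∧
  ∀ β : N → ℝ, ∀ q : G → ℝ, DualFeasible k c β q →
    ∑ i, α i + ∑ j, s j * p j ≤ ∑ i, β i + ∑ j, s j * q j

open Topology

/-- Along `𝓝[>] 0`, small multiples of `b` stay below `a ≥ 0`, provided `b ≤ 0` when `a = 0`. -/
theorem eventually_mul_le_of_nonneg {a b : ℝ} (ha : 0 ≤ a) (hab : a = 0 → b ≤ 0) :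
    ∀ᶠ ε in 𝓝[>] (0 : ℝ), ε * b ≤ a := by
  rcases ha.eq_or_lt with h | h
  · filter_upwards [self_mem_nhdsWithin] with ε hε
    rw [← h]
    exact mul_nonpos_of_nonneg_of_nonpos (le_of_lt hε) (hab h.symm)
  · have hc : Filter.Tendsto (fun ε : ℝ => ε * b) (𝓝[>] 0) (𝓝 0) := by
      have : Continuous fun ε : ℝ => ε * b := by fun_prop
      simpa using (this.tendsto 0).mono_left nhdsWithin_le_nhds
    exact (hc.eventually_lt_const h).mono fun _ => le_of_lt

section LIP

variable {N G : Type*} [Fintype G] {k : ℕ}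

/-- The allocations of at most one bundle in total to each agent, supported on the bundles. -/
def demandSet (N G : Type*) [Fintype G] (k : ℕ) : Set (N → (G → ℕ) → ℝ) :=
  {x | (∀ i B, 0 ≤ x i B) ∧ (∀ i, ∀ B ∉ kBundles G k, x i B = 0) ∧
    ∀ i, ∑ B ∈ kBundles G k, x i B ≤ 1}

theorem isCompact_demandSet : IsCompact (demandSet N G k) := by
  have hbox : IsCompact (Set.univ.pi fun _ : N => Set.univ.pi fun _ : G → ℕ =>
      Set.Icc (0 : ℝ) 1) :=
    isCompact_univ_pi fun _ => isCompact_univ_pi fun _ => isCompact_Icc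
  refine hbox.of_isClosed_subset ?_ ?_
  · simp only [demandSet, Set.ofPred_and, Set.ofPred_forall]
    refine IsClosed.inter ?_ (IsClosed.inter ?_ ?_)
    · exact isClosed_iInter fun i => isClosed_iInter fun B =>
        isClosed_le (by fun_prop) (by fun_prop)
    · exact isClosed_iInter fun i => isClosed_iInter fun B => isClosed_iInter fun _ =>
        isClosed_eq (by fun_prop) (by fun_prop)
    · exact isClosed_iInter fun i => isClosed_le (by fun_prop) (by fun_prop)
  · rintro x ⟨h0, hout, h1⟩ i - B -
    refine ⟨h0 i B, ?_⟩
    by_cases hB : B ∈ kBundles G k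
    · exact (Finset.single_le_sum (fun B _ => h0 i B) hB).trans (h1 i)
    · simp [hout i B hB]

theorem convex_demandSet : Convex ℝ (demandSet N G k) := by
  rintro x ⟨hx0, hxo, hx1⟩ y ⟨hy0, hyo, hy1⟩ a b ha hb hab
  refine ⟨fun i B => ?_, fun i B hB => ?_, fun i => ?_⟩
  · exact add_nonneg (mul_nonneg ha (hx0 i B)) (mul_nonneg hb (hy0 i B))
  · simp [hxo i B hB, hyo i B hB]
  · simp only [Pi.add_apply, Pi.smul_apply, smul_eq_mul, Finset.sum_add_distrib,
      ← Finset.mul_sum]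
    nlinarith [hx1 i, hy1 i]

variable [Fintype N]

theorem sum_price_mul_load (x : N → (G → ℕ) → ℝ) (p : G → ℝ) :
    ∑ j, p j * ∑ i, ∑ B ∈ kBundles G k, (B j : ℝ) * x i B =
      ∑ i, ∑ B ∈ kBundles G k, (∑ j, (B j : ℝ) * p j) * x i B := by
  simp_rw [Finset.mul_sum, Finset.sum_mul]
  rw [Finset.sum_comm]
  refine Finset.sum_congr rfl fun i _ => ?_
  rw [Finset.sum_comm]
  exact Finset.sum_congr rfl fun B _ => Finset.sum_congr rfl fun j _ => by ring

/-- The duality gap as a sum of complementarity terms. -/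
theorem duality_gap_eq (c : N → (G → ℕ) → ℝ) (s : G → ℝ) (x : N → (G → ℕ) → ℝ)
    (α : N → ℝ) (p : G → ℝ) :
    ∑ i, α i + ∑ j, s j * p j - ∑ i, ∑ B ∈ kBundles G k, c i B * x i B =
      ∑ i, α i * (1 - ∑ B ∈ kBundles G k, x i B) +
      ∑ j, p j * (s j - ∑ i, ∑ B ∈ kBundles G k, (B j : ℝ) * x i B) +
      ∑ i, ∑ B ∈ kBundles G k, (α i + ∑ j, (B j : ℝ) * p j - c i B) * x i B := by
  simp_rw [mul_sub, sub_mul, add_mul, Finset.sum_sub_distrib, Finset.sum_add_distrib,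
    sum_price_mul_load, Finset.mul_sum, mul_one, mul_comm (s _)]
  ring

theorem DualFeasible.weak_duality {c : N → (G → ℕ) → ℝ} {s : G → ℝ} {x : N → (G → ℕ) → ℝ}
    {α : N → ℝ} {p : G → ℝ} (hd : DualFeasible k c α p) (hx : LIPFeasible k s x) :
    ∑ i, ∑ B ∈ kBundles G k, c i B * x i B ≤ ∑ i, α i + ∑ j, s j * p j := by
  obtain ⟨hα, hp, hc⟩ := hd
  obtain ⟨h0, h1, h2⟩ := hx
  rw [← sub_nonneg, duality_gap_eq]
  refine add_nonneg (add_nonneg (Finset.sum_nonneg fun i _ => ?_)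
    (Finset.sum_nonneg fun j _ => ?_))
    (Finset.sum_nonneg fun i _ => Finset.sum_nonneg fun B hB => ?_)
  · exact mul_nonneg (hα i) (sub_nonneg.2 (h1 i))
  · exact mul_nonneg (hp j) (sub_nonneg.2 (h2 j))
  · exact mul_nonneg (sub_nonneg.2 (hc i B hB)) (h0 i B hB)

/-- Loads and value of an allocation, as a linear map. -/
noncomputable def loadValue (k : ℕ) (c : N → (G → ℕ) → ℝ) :
    (N → (G → ℕ) → ℝ) →ₗ[ℝ] (G → ℝ) × ℝ where
  toFun x := (fun j => ∑ i, ∑ B ∈ kBundles G k, (B j : ℝ) * x i B,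
    ∑ i, ∑ B ∈ kBundles G k, c i B * x i B)
  map_add' x y := by
    ext <;> simp [mul_add, Finset.sum_add_distrib]
  map_smul' a x := by
    ext <;> simp [Finset.mul_sum, mul_left_comm]

/-- The largest positive part of finitely many reals is a weighted sum with subunit weights. -/
theorem exists_max_weights {ι : Type*} (K : Finset ι) (r : ι → ℝ) :
    ∃ β : ℝ, ∃ y : ι → ℝ, 0 ≤ β ∧ (∀ B ∈ K, r B ≤ β) ∧ (∀ B, 0 ≤ y B) ∧
      (∀ B ∉ K, y B = 0) ∧ ∑ B ∈ K, y B ≤ 1 ∧ ∑ B ∈ K, r B * y B = β := by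
  classical
  by_cases h : ∃ B ∈ K, 0 ≤ r B
  · obtain ⟨B₁, hB₁, hr⟩ := h
    obtain ⟨B₀, hB₀, hmax⟩ := K.exists_max_image r ⟨B₁, hB₁⟩
    refine ⟨r B₀, Pi.single B₀ 1, hr.trans (hmax _ hB₁), hmax, fun B => ?_, fun B hB => ?_,
      ?_, ?_⟩
    · by_cases h : B = B₀
      · simp [h]
      · simp [h]
    · exact Pi.single_eq_of_ne (ne_of_mem_of_not_mem hB₀ hB).symm _
    · simp [Pi.single_apply, hB₀]
    · simp [Pi.single_apply, hB₀]
  · push Not at h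
    exact ⟨0, 0, le_rfl, fun B hB => (h B hB).le, by simp, by simp, by simp, by simp⟩

open scoped Pointwise in
/-- The dual program has no duality gap in the limit. -/
theorem LIPOptimal.exists_dualFeasible_lt {c : N → (G → ℕ) → ℝ} {s : G → ℝ}
    {x : N → (G → ℕ) → ℝ} (hx : LIPOptimal k c s x) {ε : ℝ} (hε : 0 < ε) :
    ∃ β : N → ℝ, ∃ q : G → ℝ, DualFeasible k c β q ∧
      ∑ i, β i + ∑ j, s j * q j < ∑ i, ∑ B ∈ kBundles G k, c i B * x i B + ε := by
  classical
  obtain ⟨⟨hx0, hx1, hxs⟩, hxmax⟩ := hx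
  set v := ∑ i, ∑ B ∈ kBundles G k, c i B * x i B with hv
  set C : Set ((G → ℝ) × ℝ) :=
    loadValue k c '' demandSet N G k + Set.Ici (0 : G → ℝ) ×ˢ Set.Iic (0 : ℝ)
  have hLcont : Continuous (loadValue k c) := by
    change Continuous fun x : N → (G → ℕ) → ℝ =>
      ((fun j => ∑ i, ∑ B ∈ kBundles G k, (B j : ℝ) * x i B : G → ℝ),
        ∑ i, ∑ B ∈ kBundles G k, c i B * x i B)
    fun_prop
  have hCclosed : IsClosed C :=
    (isClosed_Ici.prod isClosed_Iic).add_left_of_isCompact (isCompact_demandSet.image hLcont)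
  have hCconv : Convex ℝ C :=
    (convex_demandSet.linear_image _).add ((convex_Ici _).prod (convex_Iic _))
  have hmem : ∀ y ∈ demandSet N G k, ∀ (w : G → ℝ) (r : ℝ), 0 ≤ w → r ≤ 0 →
      loadValue k c y + (w, r) ∈ C := fun y hy w r hw hr =>
    Set.add_mem_add (Set.mem_image_of_mem _ hy) ⟨hw, hr⟩
  have hnot : (s, v + ε) ∉ C := by
    rintro ⟨_, ⟨y, ⟨hy0, -, hy1⟩, rfl⟩, ⟨w, r⟩, ⟨hw, hr⟩, heq⟩
    have h1 := congrArg Prod.fst heq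
    have h2 : ∑ i, ∑ B ∈ kBundles G k, c i B * y i B + r = v + ε := congrArg Prod.snd heq
    have := hxmax y ⟨fun i B _ => hy0 i B, hy1, fun j => by
      have h3 : ∑ i, ∑ B ∈ kBundles G k, (B j : ℝ) * y i B + w j = s j := congrFun h1 j
      have : 0 ≤ w j := hw j
      linarith⟩
    have : r ≤ 0 := hr
    linarith
  obtain ⟨f, u, hfu, hu⟩ := geometric_hahn_banach_point_closed hCconv hCclosed hnot
  set p : G → ℝ := fun j => f (Pi.single j 1, 0) with hp
  set m : ℝ := f (0, 1) with hm
  have hf : ∀ w r, f (w, r) = ∑ j, w j * p j + r * m := by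
    intro w r
    have : ((w, r) : (G → ℝ) × ℝ) =
        ∑ j, w j • ((Pi.single j 1, 0) : (G → ℝ) × ℝ) + r • ((0, 1) : (G → ℝ) × ℝ) := by
      ext j
      · simp [Prod.fst_sum, Finset.sum_apply, Pi.single_apply]
      · simp [Prod.snd_sum]
    rw [this, map_add, map_sum, map_smul]
    simp_rw [map_smul]
    simp only [smul_eq_mul, hp, hm]
  have hzero : (0 : N → (G → ℕ) → ℝ) ∈ demandSet N G k :=
    ⟨by simp, by simp, by simp⟩
  have hu0 : u < 0 := by
    have := hu _ (hmem 0 hzero 0 0 le_rfl le_rfl)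
    rw [map_zero, zero_add, hf] at this
    simpa using this
  have hpnn : ∀ j, 0 ≤ p j := by
    intro j
    by_contra! hj
    have := hu _ (hmem 0 hzero (Pi.single j (u / p j)) 0
      (Pi.single_nonneg.2 (div_pos_of_neg_of_neg hu0 hj).le) le_rfl)
    rw [map_zero, zero_add, hf] at this
    simp [Pi.single_apply, hj.ne] at this
  have hmneg : m < 0 := by
    let x' : N → (G → ℕ) → ℝ := fun i B => if B ∈ kBundles G k then x i B else 0
    have hx' : x' ∈ demandSet N G k := by
      refine ⟨fun i B => ?_, fun i B hB => by simp [x', hB], fun i => ?_⟩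
      · by_cases hB : B ∈ kBundles G k
        · simpa [x', hB] using hx0 i B hB
        · simp [x', hB]
      · exact (Finset.sum_congr rfl fun B hB => if_pos hB).trans_le (hx1 i)
    have hL : loadValue k c x' + (fun j => s j -
        ∑ i, ∑ B ∈ kBundles G k, (B j : ℝ) * x i B, 0) = (s, v) := by
      ext j
      · simp +contextual [loadValue, x']
      · simp +contextual [loadValue, x', hv]
    have := hu _ (hmem x' hx' _ 0 (fun j => sub_nonneg.2 (hxs j)) le_rfl)
    rw [hL, hf] at this
    rw [hf] at hfu
    nlinarith
  set q : G → ℝ := fun j => p j / (-m)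
  choose β y hβ hcβ hy0 hyo hy1 hyβ using fun i : N =>
    exists_max_weights (kBundles G k) fun B => c i B - ∑ j, (B j : ℝ) * q j
  refine ⟨β, q, ⟨hβ, fun j => div_nonneg (hpnn j) (by linarith), fun i B hB => ?_⟩, ?_⟩
  · linarith [hcβ i B hB]
  · have h1 := hu _ (hmem y ⟨hy0, hyo, hy1⟩ 0 0 le_rfl le_rfl)
    have h2 : loadValue k c y + (0, 0) = (fun j => ∑ i, ∑ B ∈ kBundles G k, (B j : ℝ) * y i B,
      ∑ i, ∑ B ∈ kBundles G k, c i B * y i B) := add_zero _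
    rw [h2, hf] at h1
    rw [hf] at hfu
    have hpq : ∀ j, p j = q j * -m := fun j =>
      (div_mul_cancel₀ _ (neg_pos.2 hmneg).ne').symm
    have h3 : ∑ i, β i = ∑ i, ∑ B ∈ kBundles G k, c i B * y i B -
        ∑ j, q j * ∑ i, ∑ B ∈ kBundles G k, (B j : ℝ) * y i B := by
      rw [sum_price_mul_load, ← Finset.sum_sub_distrib]
      refine Finset.sum_congr rfl fun i _ => ?_
      rw [← hyβ i, ← Finset.sum_sub_distrib]
      exact Finset.sum_congr rfl fun B _ => by ring
    have h4 : ∀ w : G → ℝ, ∑ j, w j * p j = (∑ j, q j * w j) * -m := fun w => by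
      rw [Finset.sum_mul]
      exact Finset.sum_congr rfl fun j _ => by rw [hpq]; ring
    rw [h4] at h1 hfu
    have h5 := hfu.trans h1
    have h6 : ∑ j, s j * q j = ∑ j, q j * s j := Finset.sum_congr rfl fun j _ => mul_comm _ _
    rw [h3, h6]
    by_contra! hcon
    nlinarith

theorem LIPOptimal.dual_value_le {c : N → (G → ℕ) → ℝ} {s : G → ℝ} {x : N → (G → ℕ) → ℝ}
    {α : N → ℝ} {p : G → ℝ} (hx : LIPOptimal k c s x) (hd : DualOptimal k c s α p) :
    ∑ i, α i + ∑ j, s j * p j ≤ ∑ i, ∑ B ∈ kBundles G k, c i B * x i B := by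
  refine le_of_forall_pos_le_add fun ε hε => ?_
  obtain ⟨β, q, hβq, hlt⟩ := hx.exists_dualFeasible_lt hε
  exact (hd.2 β q hβq).trans hlt.le

/-- `x'` with supplies `s'` satisfies, up to a factor `ε`, every slackness that `x` has
with supplies `s`. -/
structure SlackLE (k : ℕ) (ε : ℝ) (s' : G → ℝ) (x' : N → (G → ℕ) → ℝ) (s : G → ℝ)
    (x : N → (G → ℕ) → ℝ) : Prop where
  mul_le : ∀ i, ∀ B ∈ kBundles G k, ε * x' i B ≤ x i B
  demand : ∀ i, ε * (1 - ∑ B ∈ kBundles G k, x' i B) ≤ 1 - ∑ B ∈ kBundles G k, x i B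
  supply : ∀ j, ε * (s' j - ∑ i, ∑ B ∈ kBundles G k, (B j : ℝ) * x' i B) ≤
    s j - ∑ i, ∑ B ∈ kBundles G k, (B j : ℝ) * x i B

theorem SlackLE.lipOptimal {c : N → (G → ℕ) → ℝ} {s s' : G → ℝ} {x x' : N → (G → ℕ) → ℝ}
    {ε : ℝ} (h : SlackLE k ε s' x' s x) (hε : 0 < ε) (hx : LIPOptimal k c s x)
    (hx' : LIPFeasible k s' x') : LIPOptimal k c s' x' := by
  refine ⟨hx', fun y ⟨hy0, hy1, hys⟩ => ?_⟩
  have key := hx.2 (fun i B => x i B + ε * (y i B - x' i B)) ⟨fun i B hB => ?_, fun i => ?_,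
    fun j => ?_⟩
  · simp only [mul_add, mul_sub, mul_left_comm _ ε, Finset.sum_add_distrib,
      Finset.sum_sub_distrib, ← Finset.mul_sum] at key
    nlinarith
  · nlinarith [h.mul_le i B hB, mul_nonneg hε.le (hy0 i B hB)]
  · simp only [mul_sub, Finset.sum_add_distrib, Finset.sum_sub_distrib, ← Finset.mul_sum]
    nlinarith [h.demand i, mul_le_mul_of_nonneg_left (hy1 i) hε.le]
  · simp only [mul_add, mul_sub, mul_left_comm _ ε, Finset.sum_add_distrib,
      Finset.sum_sub_distrib, ← Finset.mul_sum]
    nlinarith [h.supply j, mul_le_mul_of_nonneg_left (hys j) hε.le]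

theorem SlackLE.dualOptimal {c : N → (G → ℕ) → ℝ} {s s' : G → ℝ} {x x' : N → (G → ℕ) → ℝ}
    {ε : ℝ} (h : SlackLE k ε s' x' s x) (hε : 0 < ε) (hx : LIPOptimal k c s x)
    (hx' : LIPFeasible k s' x') {α : N → ℝ} {p : G → ℝ} (hd : DualOptimal k c s α p) :
    DualOptimal k c s' α p := by
  refine ⟨hd.1, fun β q hβq => le_trans ?_ (hβq.weak_duality hx')⟩
  obtain ⟨hα, hp, hc⟩ := hd.1
  have hgap := sub_nonpos.2 (hx.dual_value_le hd)
  suffices ε * (∑ i, α i + ∑ j, s' j * p j - ∑ i, ∑ B ∈ kBundles G k, c i B * x' i B) ≤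
      ∑ i, α i + ∑ j, s j * p j - ∑ i, ∑ B ∈ kBundles G k, c i B * x i B from
    sub_nonpos.1 (nonpos_of_mul_nonpos_right (this.trans hgap) hε)
  rw [duality_gap_eq, duality_gap_eq]
  simp only [mul_add ε, Finset.mul_sum (a := ε), mul_left_comm ε]
  gcongr with i _ j _ i _ B hB
  · exact hα i
  · exact h.demand i
  · exact hp j
  · exact h.supply j
  · exact sub_nonneg.2 (hc i B hB)
  · exact h.mul_le i B hB

end LIP

open Classical in
theorem stmt0 {N G : Type*} [Fintype N] [Fintype G] [Nonempty N] [Nonempty G]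
    (k : ℕ) (hk : 1 ≤ k)
    (c : N → (G → ℕ) → ℝ) (stil s : G → ℝ) (hss : ∀ j, stil j ≤ s j)
    (xstar : N → (G → ℕ) → ℝ) (hxstar : LIPOptimal k c stil xstar)
    (xbar : N → (G → ℕ) → ℝ)
    (hpos : ∀ i, ∀ B ∈ kBundles G k, 0 ≤ xbar i B)
    (hzero : ∀ i, ∀ B ∈ kBundles G k, xstar i B = 0 → xbar i B = 0)
    (hone : ∀ i, ∑ B ∈ kBundles G k, xstar i B = 1 → ∑ B ∈ kBundles G k, xbar i B = 1)
    (hdem : ∀ i, ∑ B ∈ kBundles G k, xbar i B ≤ 1)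
    (hsup : ∀ j, ∑ i, ∑ B ∈ kBundles G k, (B j : ℝ) * xbar i B ≤ s j + k - 1)
    (sbar : G → ℝ)
    (hsbar : ∀ j, sbar j =
      if (∑ i, ∑ B ∈ kBundles G k, (B j : ℝ) * xstar i B < stil j ∧
          ∑ i, ∑ B ∈ kBundles G k, (B j : ℝ) * xbar i B ≤ stil j)
      then stil j
      else ∑ i, ∑ B ∈ kBundles G k, (B j : ℝ) * xbar i B) :
    (∀ j, sbar j ≤ s j + k - 1) ∧
    LIPOptimal k c sbar xbar ∧
    (∀ α : N → ℝ, ∀ p : G → ℝ, DualOptimal k c stil α p → DualOptimal k c sbar α p) := by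
  have hload : ∀ j, ∑ i, ∑ B ∈ kBundles G k, (B j : ℝ) * xbar i B ≤ sbar j := by
    intro j
    rw [hsbar j]
    split_ifs with h
    · exact h.2
    · exact le_rfl
  have hfeas : LIPFeasible k sbar xbar := ⟨hpos, hdem, hload⟩
  have hslack : ∃ ε : ℝ, 0 < ε ∧ SlackLE k ε sbar xbar stil xstar := by
    obtain ⟨h0, h1, h2⟩ := hxstar.1
    have e0 : ∀ᶠ ε in 𝓝[>] (0 : ℝ), ∀ i, ∀ B ∈ kBundles G k, ε * xbar i B ≤ xstar i B := by
      rw [Filter.eventually_all]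
      intro i
      rw [Filter.eventually_all_finset]
      exact fun B hB =>
        eventually_mul_le_of_nonneg (h0 i B hB) fun h => (hzero i B hB h).le
    have e1 : ∀ᶠ ε in 𝓝[>] (0 : ℝ), ∀ i, ε * (1 - ∑ B ∈ kBundles G k, xbar i B) ≤
        1 - ∑ B ∈ kBundles G k, xstar i B :=
      Filter.eventually_all.2 fun i =>
        eventually_mul_le_of_nonneg (sub_nonneg.2 (h1 i)) fun h => by
          rw [hone i (sub_eq_zero.1 h).symm, sub_self]
    have e2 : ∀ᶠ ε in 𝓝[>] (0 : ℝ), ∀ j,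
        ε * (sbar j - ∑ i, ∑ B ∈ kBundles G k, (B j : ℝ) * xbar i B) ≤
        stil j - ∑ i, ∑ B ∈ kBundles G k, (B j : ℝ) * xstar i B :=
      Filter.eventually_all.2 fun j =>
        eventually_mul_le_of_nonneg (sub_nonneg.2 (h2 j)) fun h => by
          rw [hsbar j, if_neg fun h' => (sub_pos.2 h'.1).ne' h, sub_self]
    obtain ⟨ε, ⟨⟨he0, he1⟩, he2⟩, hε⟩ := ((e0.and e1).and e2 |>.and self_mem_nhdsWithin).exists
    exact ⟨ε, hε, he0, he1, he2⟩
  obtain ⟨ε, hε, hs⟩ := hslack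
  refine ⟨fun j => ?_, hs.lipOptimal hε hxstar hfeas, fun α p hd =>
    hs.dualOptimal hε hxstar hfeas hd⟩
  rw [hsbar j]
  split_ifs with h
  · have : (1 : ℝ) ≤ k := by exact_mod_cast hk
    linarith [hss j]
  · exact hsup j
end

section
/- Let N and G be finite nonempty sets, let k ≥ 1 be an integer, and let 𝓑 be the set of k-bundles. Let u : N → 𝓑 → ℝ with u_i(B) ≥ 0 for all i, B, let 0 ≤ δ_w < 1, let w : N → 𝓑 → ℝ with 1 − δ_w ≤ w_i(B) ≤ 1 + δ_w for all i, B, and let s̄ : G → ℝ. For each i ∈ N set M_i = max_{B∈𝓑} u_i(B). Suppose x̄ : N → 𝓑 → ℝ takes values in {0,1}, satisfies Σ_{B∈𝓑} x̄_i(B) ≤ 1 for all i ∈ N, and is an optimal solution of (LIP) with rewards c_i(B) = w_i(B)u_i(B) and supplies s̄. Then there exists p : G → ℝ with p ≥ 0 such that, writing P(B) = Σ_{j∈G} B_j p_j: (a) for every i ∈ N and B̂ ∈ 𝓑 with x̄_i(B̂) = 1, one has u_i(B̂) − P(B̂) ≥ u_i(B) − P(B) − 2δ_w M_i for all B ∈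 𝓑; (b) for every i ∈ N with Σ_{B∈𝓑} x̄_i(B) = 0, one has u_i(B) − P(B) ≤ δ_w M_i for all B ∈ 𝓑. In particular, the set of supporting prices associated with x̄ (with acceptable error ε_u ≥ 2δ_w M_i for all i) is nonempty. -/
/-- **Farkas' lemma** for finitely many linear functionals on a real vector space. -/
theorem exists_nonneg_eq_sum_smul_of_forall_nonpos {ι V : Type*} [AddCommGroup V] [Module ℝ V]
    (s : Finset ι) (a : ι → V →ₗ[ℝ] ℝ) (b : V →ₗ[ℝ] ℝ)
    (h : ∀ x, (∀ i ∈ s, a i x ≤ 0) → b x ≤ 0) :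
    ∃ l : ι → ℝ, (∀ i, 0 ≤ l i) ∧ b = ∑ i ∈ s, l i • a i := by
  classical
  induction s using Finset.induction_on generalizing a b with
  | empty =>
    refine ⟨0, fun _ => le_rfl, ?_⟩
    ext x
    have h₁ := h x (by simp)
    have h₂ := h (-x) (by simp)
    simp only [map_neg] at h₂
    simp only [Finset.sum_empty, LinearMap.zero_apply]
    linarith
  | insert m s hm ih =>
    by_cases hs : ∀ x, (∀ i ∈ s, a i x ≤ 0) → b x ≤ 0
    · obtain ⟨l, hl, hb⟩ := ih a b hs
      refine ⟨Function.update l m 0, fun i => ?_, ?_⟩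
      · by_cases him : i = m
        · simp [him]
        · simpa [him] using hl i
      · rw [Finset.sum_insert hm, hb]
        simp only [Function.update_self, zero_smul, zero_add]
        refine Finset.sum_congr rfl fun i hi => ?_
        rw [Function.update_of_ne (ne_of_mem_of_not_mem hi hm)]
    · push Not at hs
      obtain ⟨z, hz, hbz⟩ := hs
      have hmz : 0 < a m z := by
        by_contra! hmz
        refine hbz.not_ge (h z fun i hi => ?_)
        rcases Finset.mem_insert.1 hi with rfl | hi
        exacts [hmz, hz i hi]
      obtain ⟨l, hl, hb⟩ := ih (fun i => a i - (a i z / a m z) • a m)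
        (b - (b z / a m z) • a m) (by
          intro x hx
          have key : ∀ f : V →ₗ[ℝ] ℝ, (f - (f z / a m z) • a m) x =
              f (x - (a m x / a m z) • z) := by
            intro f
            simp only [LinearMap.sub_apply, LinearMap.smul_apply, map_sub, map_smul, smul_eq_mul]
            ring
          rw [key]
          refine h _ fun i hi => ?_
          rcases Finset.mem_insert.1 hi with rfl | hi
          · simp [hmz.ne']
          · rw [← key]
            exact hx i hi)
      refine ⟨Function.update l m (b z / a m z - ∑ i ∈ s, l i * (a i z / a m z)), fun i => ?_, ?_⟩
      · by_cases him : i = m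
        · subst him
          have h₁ : ∑ j ∈ s, l j * (a j z / a i z) ≤ 0 := Finset.sum_nonpos fun j hj =>
            mul_nonpos_of_nonneg_of_nonpos (hl j) (div_nonpos_of_nonpos_of_nonneg (hz j hj) hmz.le)
          have h₂ : 0 < b z / a i z := div_pos hbz hmz
          simp only [Function.update_self]
          linarith
        · simpa [him] using hl i
      · rw [Finset.sum_insert hm, Function.update_self]
        have hsum : ∑ i ∈ s, Function.update l m
            (b z / a m z - ∑ i ∈ s, l i * (a i z / a m z)) i • a i = ∑ i ∈ s, l i • a i :=
          Finset.sum_congr rfl fun i hi => by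
            rw [Function.update_of_ne (ne_of_mem_of_not_mem hi hm)]
        rw [hsum]
        rw [sub_eq_iff_eq_add] at hb
        refine hb.trans ?_
        simp only [smul_sub, Finset.sum_sub_distrib, smul_smul]
        rw [← Finset.sum_smul]
        module

open Filter Topology in
/-- An optimal solution of a linear program with finitely many inequality constraints admits
nonnegative multipliers satisfying complementary slackness. -/
theorem exists_multipliers_of_isMaxOn {ι V : Type*} [Fintype ι] [AddCommGroup V] [Module ℝ V]
    (a : ι → V →ₗ[ℝ] ℝ) (β : ι → ℝ) (c : V →ₗ[ℝ] ℝ) (x : V) (hx : ∀ i, a i x ≤ β i)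
    (hmax : ∀ y, (∀ i, a i y ≤ β i) → c y ≤ c x) :
    ∃ l : ι → ℝ, (∀ i, 0 ≤ l i) ∧ (∀ i, a i x < β i → l i = 0) ∧ c = ∑ i, l i • a i := by
  classical
  obtain ⟨l, hl, hc⟩ := exists_nonneg_eq_sum_smul_of_forall_nonpos
    (Finset.univ.filter fun i => a i x = β i) a c (by
      intro d hd
      have hev : ∀ᶠ ε : ℝ in 𝓝[>] 0, ∀ i, a i (x + ε • d) ≤ β i := by
        refine eventually_all.2 fun i => ?_
        rcases (hx i).lt_or_eq with hlt | heq
        · have hcont : Continuous fun ε : ℝ => a i (x + ε • d) := by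
            simp only [map_add, map_smul, smul_eq_mul]
            fun_prop
          have := hcont.tendsto 0
          simp only [zero_smul, add_zero] at this
          exact nhdsWithin_le_nhds ((this.eventually_lt_const hlt).mono fun _ h => h.le)
        · filter_upwards [self_mem_nhdsWithin] with ε hε
          have h₁ : a i d ≤ 0 := hd i (by simp [heq])
          have h₂ : ε * a i d ≤ 0 := mul_nonpos_of_nonneg_of_nonpos (le_of_lt hε) h₁
          simp only [map_add, map_smul, smul_eq_mul]
          linarith
      obtain ⟨ε, hfeas, hε⟩ := (hev.and self_mem_nhdsWithin).exists
      have hle := hmax _ hfeas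
      simp only [map_add, map_smul, smul_eq_mul] at hle
      have hε : 0 < ε := hε
      by_contra! hpos
      linarith [mul_pos hε hpos])
  refine ⟨fun i => if a i x = β i then l i else 0, fun i => ?_, fun i hi => if_neg hi.ne, ?_⟩
  · dsimp only
    split_ifs
    exacts [hl i, le_rfl]
  · simp only [ite_smul, zero_smul]
    rw [hc, Finset.sum_filter]

/-- Dual prices of an optimal solution of (LIP), together with complementary slackness. -/
theorem LIPOptimal.exists_dual {N G : Type*} [Fintype N] [Fintype G] {k : ℕ}
    {c : N → (G → ℕ) → ℝ} {s : G → ℝ} {x : N → (G → ℕ) → ℝ} (hopt : LIPOptimal k c s x) :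
    ∃ (π : N → ℝ) (p : G → ℝ), (∀ j, 0 ≤ p j) ∧
      (∀ i, ∑ B ∈ kBundles G k, x i B < 1 → π i = 0) ∧
      (∀ i, ∀ B ∈ kBundles G k, c i B ≤ π i + ∑ j, (B j : ℝ) * p j) ∧
      (∀ i, ∀ B ∈ kBundles G k, 0 < x i B → c i B = π i + ∑ j, (B j : ℝ) * p j) := by
  classical
  let e (i : N) (B : G → ℕ) : (N → (G → ℕ) → ℝ) →ₗ[ℝ] ℝ :=
    (LinearMap.proj (R := ℝ) (φ := fun _ : G → ℕ => ℝ) B).comp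
      (LinearMap.proj (R := ℝ) (φ := fun _ : N => (G → ℕ) → ℝ) i)
  let a : (N × kBundles G k) ⊕ N ⊕ G → (N → (G → ℕ) → ℝ) →ₗ[ℝ] ℝ :=
    Sum.elim (fun q => -e q.1 q.2) (Sum.elim (fun i => ∑ B ∈ kBundles G k, e i B)
      fun j => ∑ i, ∑ B ∈ kBundles G k, (B j : ℝ) • e i B)
  let β : (N × kBundles G k) ⊕ N ⊕ G → ℝ := Sum.elim (fun _ => 0) (Sum.elim (fun _ => 1) s)
  have hfeas : ∀ y, (∀ t, a t y ≤ β t) ↔ LIPFeasible k s y := by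
    intro y
    simp [a, β, e, LIPFeasible, Sum.forall]
  obtain ⟨l, hl, hslack, hc⟩ := exists_multipliers_of_isMaxOn a β
    (∑ i, ∑ B ∈ kBundles G k, c i B • e i B) x ((hfeas x).2 hopt.1) (by
      intro y hy
      simpa [e] using hopt.2 y ((hfeas y).1 hy))
  have hdual : ∀ i, ∀ B (hB : B ∈ kBundles G k), c i B = -l (.inl (i, ⟨B, hB⟩)) +
      (l (.inr (.inl i)) + ∑ j, (B j : ℝ) * l (.inr (.inr j))) := by
    intro i B hB
    have h := LinearMap.congr_fun hc (Pi.single i (Pi.single B 1))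
    have hsub (q : kBundles G k) : (q : G → ℕ) = B ↔ q = ⟨B, hB⟩ := by rw [Subtype.ext_iff]
    simpa [a, e, Fintype.sum_sum_type, Fintype.sum_prod_type, Pi.single_apply, ite_apply,
      Finset.sum_ite_irrel, hB, hsub, mul_comm] using h
  refine ⟨fun i => l (.inr (.inl i)), fun j => l (.inr (.inr j)), fun j => hl _, fun i hi => ?_,
    fun i B hB => ?_, fun i B hB hpos => ?_⟩
  · exact hslack _ (by simpa [a, β, e] using hi)
  · linarith [hdual i B hB, hl (.inl (i, ⟨B, hB⟩))]
  · rw [hdual i B hB, hslack (.inl (i, ⟨B, hB⟩)) (by simpa [a, β, e] using hpos)]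
    ring

theorem stmt1 {N G : Type*} [Fintype N] [Fintype G] [Nonempty N] [Nonempty G]
    (k : ℕ) (hk : 1 ≤ k)
    (u : N → (G → ℕ) → ℝ) (hu : ∀ i, ∀ B ∈ kBundles G k, 0 ≤ u i B)
    (δw : ℝ) (hδ0 : 0 ≤ δw) (hδ1 : δw < 1)
    (w : N → (G → ℕ) → ℝ)
    (hw : ∀ i, ∀ B ∈ kBundles G k, 1 - δw ≤ w i B ∧ w i B ≤ 1 + δw)
    (sbar : G → ℝ)
    (M : N → ℝ)
    (hM : ∀ i, IsGreatest {v : ℝ | ∃ B ∈ kBundles G k, u i B = v} (M i))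
    (xbar : N → (G → ℕ) → ℝ)
    (hbin : ∀ i, ∀ B ∈ kBundles G k, xbar i B = 0 ∨ xbar i B = 1)
    (hdem : ∀ i, ∑ B ∈ kBundles G k, xbar i B ≤ 1)
    (hopt : LIPOptimal k (fun i B => w i B * u i B) sbar xbar) :
    ∃ p : G → ℝ, (∀ j, 0 ≤ p j) ∧
      (∀ i, ∀ Bhat ∈ kBundles G k, xbar i Bhat = 1 →
        ∀ B ∈ kBundles G k,
          u i Bhat - ∑ j, (Bhat j : ℝ) * p j ≥
            u i B - ∑ j, (B j : ℝ) * p j - 2 * δw * M i) ∧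
      (∀ i, ∑ B ∈ kBundles G k, xbar i B = 0 →
        ∀ B ∈ kBundles G k, u i B - ∑ j, (B j : ℝ) * p j ≤ δw * M i) := by
  obtain ⟨π, p, hp, hπ, hle, heq⟩ := hopt.exists_dual
  have hdev : ∀ i, ∀ B ∈ kBundles G k,
      u i B - δw * M i ≤ w i B * u i B ∧ w i B * u i B ≤ u i B + δw * M i := by
    intro i B hB
    have hM' : δw * u i B ≤ δw * M i :=
      mul_le_mul_of_nonneg_left ((hM i).2 ⟨B, hB, rfl⟩) hδ0
    have h₁ := mul_le_mul_of_nonneg_right (hw i B hB).1 (hu i B hB)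
    have h₂ := mul_le_mul_of_nonneg_right (hw i B hB).2 (hu i B hB)
    constructor <;> linarith
  refine ⟨p, hp, fun i Bhat hBhat hx B hB => ?_, fun i hx B hB => ?_⟩
  · have h₁ := heq i Bhat hBhat (by rw [hx]; exact one_pos)
    have h₂ := hle i B hB
    linarith [(hdev i B hB).1, (hdev i Bhat hBhat).2]
  · have h₁ := hπ i (by rw [hx]; exact one_pos)
    have h₂ := hle i B hB
    linarith [(hdev i B hB).1]
end

section
/- Let N and G be finite nonempty sets, let k ≥ 1 be an integer, and let 𝓑 be the set of k-bundles. Let u : N → 𝓑 → ℝ with u_i(B) ≥ 0 for all i, B, let 0 ≤ δ_w < 1, let w : N → 𝓑 → ℝ with 1 − δ_w ≤ w_i(B) ≤ 1 + δ_w for all i, B, let s̃ : G → ℝ, and for each i set M_i = max_{B∈𝓑} u_i(B). Let x* be an optimal solution of (LIP) with rewards c_i(B) = w_i(B)u_i(B) and supplies s̃, and let (α*, p*) be an optimal solution of the dual of this (LIP). Define the bundle price P(B) = Σ_{j∈G} B_j p*_j. Then the allocation x* is approximately envy-free under these prices: for all i, k ∈ N, Σ_{B∈𝓑} (u_i(B)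 − P(B)) x*_i(B) ≥ Σ_{B∈𝓑} (u_i(B) − P(B)) x*_k(B) − 2δ_w M_i. -/
/-- An affine function that is bounded below on `[0, ∞)` has nonnegative slope. -/
lemma slope_nonneg_of_bddBelow {a b m : ℝ} (h : ∀ r : ℝ, 0 ≤ r → m ≤ a + r * b) : 0 ≤ b := by
  by_contra! hb
  have h1 := h ((|a - m| + 1) / (-b)) (div_nonneg (by positivity) (by linarith))
  have h2 : (|a - m| + 1) / (-b) * b = -(|a - m| + 1) := by
    have : b ≠ 0 := hb.ne
    field_simp
  rw [h2] at h1
  linarith [le_abs_self (a - m)]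

/-- Lagrangian duality for a linear program over a convex set under Slater's condition. -/
lemma exists_lagrange_multiplier {E C : Type*} [AddCommGroup E] [Module ℝ E] [Fintype C]
    {P : Set E} (hP : Convex ℝ P) (A : E →ₗ[ℝ] (C → ℝ)) (b : C → ℝ) (d : E →ₗ[ℝ] ℝ) (m : ℝ)
    (hm : ∀ v ∈ P, (∀ c, b c ≤ A v c) → m ≤ d v)
    {v₀ : E} (hv₀ : v₀ ∈ P) (hslater : ∀ c, b c < A v₀ c) :
    ∃ y : C → ℝ, (∀ c, 0 ≤ y c) ∧ ∀ v ∈ P, m ≤ d v + ∑ c, y c * (b c - A v c) := by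
  classical
  let S : Set ((C → ℝ) × ℝ) := {q | ∃ v ∈ P, (∀ c, b c - A v c < q.1 c) ∧ d v < q.2}
  have hS_convex : Convex ℝ S := by
    rintro q ⟨v, hv, hq, hq'⟩ q' ⟨v', hv', hr, hr'⟩ s t hs ht hst
    refine ⟨s • v + t • v', hP hv hv' hs ht hst, fun c => ?_, ?_⟩
    · have := (convex_Ioi (0 : ℝ)) (sub_pos.2 (hq c)) (sub_pos.2 (hr c)) hs ht hst
      simp only [Set.mem_Ioi, smul_eq_mul] at this
      simp only [map_add, map_smul, Pi.add_apply, Pi.smul_apply, smul_eq_mul, Prod.fst_add,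
        Prod.smul_fst]
      have hb : b c = s * b c + t * b c := by rw [← add_mul, hst, one_mul]
      linarith
    · have := (convex_Ioi (0 : ℝ)) (sub_pos.2 hq') (sub_pos.2 hr') hs ht hst
      simp only [Set.mem_Ioi, smul_eq_mul] at this
      simp only [map_add, map_smul, smul_eq_mul, Prod.snd_add, Prod.smul_snd]
      linarith
  have hS_open : IsOpen S := by
    have : S = ⋃ v ∈ P, {q : (C → ℝ) × ℝ | (∀ c, b c - A v c < q.1 c) ∧ d v < q.2} := by
      ext q
      simp only [S, Set.mem_iUnion, Set.mem_ofPred_eq, exists_prop]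
    rw [this]
    refine isOpen_biUnion fun v _ => IsOpen.and ?_ (isOpen_lt continuous_const continuous_snd)
    simp only [Set.ofPred_forall]
    exact isOpen_iInter_of_finite fun c => isOpen_lt continuous_const (by fun_prop)
  have hmS : ((0 : C → ℝ), m) ∉ S := by
    rintro ⟨v, hv, h1, h2⟩
    exact absurd (hm v hv fun c => by have := h1 c; simp at this; linarith) (not_le.2 h2)
  obtain ⟨f, hf⟩ := geometric_hahn_banach_open_point hS_convex hS_open hmS
  set l : ℝ := -f (0, 1) with hl
  let y : C → ℝ := fun c => -f (Pi.single c 1, 0)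
  have hfy : ∀ z t, f (z, t) = -(∑ c, y c * z c) - l * t := by
    intro z t
    have h1 : ((z, t) : (C → ℝ) × ℝ) =
        ∑ c, z c • ((Pi.single c 1, 0) : (C → ℝ) × ℝ) + t • ((0, 1) : (C → ℝ) × ℝ) := by
      ext c
      · simp [Prod.fst_sum, Finset.sum_apply, Pi.single_apply]
      · simp [Prod.snd_sum]
    rw [h1, map_add, map_sum]
    simp only [map_smul, smul_eq_mul, y, hl, neg_mul, Finset.sum_neg_distrib, neg_neg]
    rw [sub_neg_eq_add, mul_comm t]
    congr 1
    exact Finset.sum_congr rfl fun c _ => mul_comm _ _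
  have key : ∀ z t, (z, t) ∈ S → l * m < ∑ c, y c * z c + l * t := by
    intro z t hzt
    have := hf _ hzt
    rw [hfy, hfy] at this
    simp at this
    linarith
  have hbase : ∀ v ∈ P, ∀ e > 0, ((fun c => b c - A v c + e, d v + e) : (C → ℝ) × ℝ) ∈ S :=
    fun v hv e he => ⟨v, hv, fun c => by simpa using he, by simpa using he⟩
  have hy : ∀ c, 0 ≤ y c := by
    intro c
    refine slope_nonneg_of_bddBelow (m := l * m)
      (a := ∑ c, y c * (b c - A v₀ c + 1) + l * (d v₀ + 1)) fun r hr => ?_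
    have := key ((fun c => b c - A v₀ c + 1) + Pi.single c r) (d v₀ + 1)
      ⟨v₀, hv₀, fun c' => ?_, by simp⟩
    · simp only [Pi.add_apply, mul_add (y _) (_ + 1), Finset.sum_add_distrib,
        Pi.single_apply, mul_ite, mul_zero, Finset.sum_ite_eq', Finset.mem_univ, if_true] at this
      linarith
    · have : (0 : ℝ) ≤ (Pi.single c r : C → ℝ) c' := by
        rw [Pi.single_apply]; split_ifs <;> simp [hr]
      simp only [Pi.add_apply]
      linarith
  have hl0 : 0 ≤ l := by
    refine slope_nonneg_of_bddBelow (m := l * m)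
      (a := ∑ c, y c * (b c - A v₀ c + 1) + l * (d v₀ + 1)) fun r hr => ?_
    have := key (fun c => b c - A v₀ c + 1) (d v₀ + 1 + r) ⟨v₀, hv₀, fun c => by simp, by
      simp only; linarith⟩
    linarith
  have hlpos : 0 < l := by
    refine lt_of_le_of_ne hl0 fun h0 => ?_
    have := key 0 (d v₀ + 1) ⟨v₀, hv₀, fun c => by simpa using hslater c, by simp⟩
    simp [← h0] at this
  have hle : ∀ v ∈ P, l * m ≤ ∑ c, y c * (b c - A v c) + l * d v := by
    intro v hv
    have hY : 0 ≤ ∑ c, y c := Finset.sum_nonneg fun c _ => hy c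
    refine le_of_forall_pos_le_add fun e he => ?_
    have hpos : 0 < ∑ c, y c + l := by linarith
    have := key _ _ (hbase v hv (e / (∑ c, y c + l)) (by positivity))
    simp only [mul_add, Finset.sum_add_distrib, ← Finset.sum_mul] at this
    have h2 : (∑ c, y c) * (e / (∑ c, y c + l)) + l * (e / (∑ c, y c + l)) = e := by
      rw [← add_mul]; field_simp
    linarith
  refine ⟨fun c => y c / l, fun c => div_nonneg (hy c) hl0, fun v hv => ?_⟩
  have h1 := hle v hv
  have h2 : ∑ c, y c / l * (b c - A v c) = (∑ c, y c * (b c - A v c)) / l := by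
    rw [Finset.sum_div]
    exact Finset.sum_congr rfl fun c _ => by ring
  rw [h2, ← mul_le_mul_iff_right₀ hlpos, mul_add, mul_div_cancel₀ _ hlpos.ne']
  linarith

/-- The value of an optimal dual solution is attained by a feasible point of (LIP). -/
lemma exists_feasible_ge_of_dualOptimal {N G : Type*} [Fintype N] [Fintype G] {k : ℕ}
    {c : N → (G → ℕ) → ℝ} {s : G → ℝ} {α : N → ℝ} {p : G → ℝ} (h : DualOptimal k c s α p) :
    ∃ x : N → (G → ℕ) → ℝ, LIPFeasible k s x ∧
      ∑ i, α i + ∑ j, s j * p j ≤ ∑ i, ∑ B ∈ kBundles G k, c i B * x i B := by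
  classical
  let A : (N → ℝ) × (G → ℝ) →ₗ[ℝ] (N × {B // B ∈ kBundles G k} → ℝ) :=
    { toFun := fun v q => v.1 q.1 + ∑ j, (q.2.1 j : ℝ) * v.2 j
      map_add' := fun v v' => by
        ext q
        simp only [Prod.fst_add, Prod.snd_add, Pi.add_apply, mul_add, Finset.sum_add_distrib]
        ring
      map_smul' := fun r v => by
        ext q
        simp only [Prod.smul_fst, Prod.smul_snd, Pi.smul_apply, smul_eq_mul, RingHom.id_apply,
          mul_add, Finset.mul_sum]
        congr 1
        exact Finset.sum_congr rfl fun j _ => by ring }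
  let d : (N → ℝ) × (G → ℝ) →ₗ[ℝ] ℝ :=
    { toFun := fun v => ∑ i, v.1 i + ∑ j, s j * v.2 j
      map_add' := fun v v' => by
        simp only [Prod.fst_add, Prod.snd_add, Pi.add_apply, mul_add, Finset.sum_add_distrib]
        ring
      map_smul' := fun r v => by
        simp only [Prod.smul_fst, Prod.smul_snd, Pi.smul_apply, smul_eq_mul, RingHom.id_apply,
          mul_add, Finset.mul_sum]
        congr 1
        exact Finset.sum_congr rfl fun j _ => by ring }
  have hA : ∀ v q, A v q = v.1 q.1 + ∑ j, (q.2.1 j : ℝ) * v.2 j := fun _ _ => rfl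
  have hd : ∀ v, d v = ∑ i, v.1 i + ∑ j, s j * v.2 j := fun _ => rfl
  obtain ⟨y, hy, hL⟩ := exists_lagrange_multiplier (convex_Ici (0 : (N → ℝ) × (G → ℝ))) A
    (fun q => c q.1 q.2.1) d (∑ i, α i + ∑ j, s j * p j)
    (fun v hv hc => h.2 v.1 v.2 ⟨fun i => hv.1 i, fun j => hv.2 j, fun i B hB => hc (i, ⟨B, hB⟩)⟩)
    (v₀ := (fun i => ∑ B ∈ kBundles G k, |c i B| + 1, 0))
    ⟨fun i => add_nonneg (Finset.sum_nonneg fun _ _ => abs_nonneg _) zero_le_one, le_rfl⟩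
    (fun q => by
      have h1 := Finset.single_le_sum (f := fun B => |c q.1 B|) (fun _ _ => abs_nonneg _) q.2.2
      have h2 := le_abs_self (c q.1 q.2.1)
      simp only [hA, Pi.zero_apply, mul_zero, Finset.sum_const_zero]
      linarith)
  let x : N → (G → ℕ) → ℝ := fun i B => if hB : B ∈ kBundles G k then y (i, ⟨B, hB⟩) else 0
  have hyx : ∀ q, y q = x q.1 q.2.1 := fun q => by simp [x]
  have hL' : ∀ v : (N → ℝ) × (G → ℝ), 0 ≤ v → ∑ i, α i + ∑ j, s j * p j ≤
      ∑ i, ∑ B ∈ kBundles G k, c i B * x i B + (∑ i, v.1 i * (1 - ∑ B ∈ kBundles G k, x i B) +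
        ∑ j, v.2 j * (s j - ∑ i, ∑ B ∈ kBundles G k, (B j : ℝ) * x i B)) := by
    intro v hv
    refine (hL v hv).trans_eq ?_
    have e1 : ∑ q, y q * (c q.1 q.2.1 - A v q) = ∑ i, ∑ B ∈ kBundles G k,
        x i B * (c i B - (v.1 i + ∑ j, (B j : ℝ) * v.2 j)) := by
      simp only [hyx, hA]
      rw [Fintype.sum_prod_type]
      refine Finset.sum_congr rfl fun i _ => ?_
      exact Finset.sum_coe_sort (kBundles G k)
        fun B => x i B * (c i B - (v.1 i + ∑ j, (B j : ℝ) * v.2 j))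
    have e2 : ∑ j, v.2 j * ∑ i, ∑ B ∈ kBundles G k, (B j : ℝ) * x i B =
        ∑ i, ∑ B ∈ kBundles G k, x i B * ∑ j, (B j : ℝ) * v.2 j := by
      simp only [Finset.mul_sum]
      rw [Finset.sum_comm]
      refine Finset.sum_congr rfl fun i _ => ?_
      rw [Finset.sum_comm]
      exact Finset.sum_congr rfl fun B _ => Finset.sum_congr rfl fun j _ => by ring
    rw [e1, hd]
    simp only [mul_sub, mul_add, mul_one, Finset.sum_sub_distrib, Finset.sum_add_distrib, e2]
    simp only [Finset.mul_sum, mul_comm]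
    ring
  refine ⟨x, ⟨fun i B hB => ?_, fun i => ?_, fun j => ?_⟩, by simpa using hL' 0 le_rfl⟩
  · simpa [x, hB] using hy (i, ⟨B, hB⟩)
  · refine sub_nonneg.1 (slope_nonneg_of_bddBelow (m := ∑ i, α i + ∑ j, s j * p j)
      (a := ∑ i, ∑ B ∈ kBundles G k, c i B * x i B) fun r hr => ?_)
    simpa [Pi.single_apply] using hL' (Pi.single i r, 0) ⟨by simpa using hr, le_rfl⟩
  · refine sub_nonneg.1 (slope_nonneg_of_bddBelow (m := ∑ i, α i + ∑ j, s j * p j)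
      (a := ∑ i, ∑ B ∈ kBundles G k, c i B * x i B) fun r hr => ?_)
    simpa [Pi.single_apply] using hL' (0, Pi.single j r) ⟨le_rfl, by simpa using hr⟩

/-- At an optimal primal-dual pair, the expected surplus of agent `i` is at least `α i`. -/
lemma le_sum_surplus_of_optimal {N G : Type*} [Fintype N] [Fintype G] {k : ℕ}
    {c : N → (G → ℕ) → ℝ} {s : G → ℝ} {x : N → (G → ℕ) → ℝ} {α : N → ℝ} {p : G → ℝ}
    (hx : LIPOptimal k c s x) (h : DualOptimal k c s α p) (i : N) :
    α i ≤ ∑ B ∈ kBundles G k, (c i B - ∑ j, (B j : ℝ) * p j) * x i B := by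
  obtain ⟨z, hz, hzv⟩ := exists_feasible_ge_of_dualOptimal h
  have hval := hzv.trans (hx.2 z hz)
  obtain ⟨⟨hx0, hx1, hxs⟩, -⟩ := hx
  obtain ⟨⟨hα, hp, hc⟩, -⟩ := h
  have hle : ∀ i, ∑ B ∈ kBundles G k, (c i B - ∑ j, (B j : ℝ) * p j) * x i B ≤ α i := fun i =>
    calc
      _ ≤ ∑ B ∈ kBundles G k, α i * x i B := Finset.sum_le_sum fun B hB =>
          mul_le_mul_of_nonneg_right (by linarith [hc i B hB]) (hx0 i B hB)
      _ = α i * ∑ B ∈ kBundles G k, x i B := by rw [Finset.mul_sum]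
      _ ≤ α i := mul_le_of_le_one_right (hα i) (hx1 i)
  have hprice : ∑ i, ∑ B ∈ kBundles G k, (∑ j, (B j : ℝ) * p j) * x i B ≤ ∑ j, s j * p j :=
    calc
      _ = ∑ j, (∑ i, ∑ B ∈ kBundles G k, (B j : ℝ) * x i B) * p j := by
          simp only [Finset.sum_mul]
          rw [Finset.sum_comm' (s := Finset.univ (α := G)) (t' := Finset.univ)
            (s' := fun _ => Finset.univ) (by simp)]
          refine Finset.sum_congr rfl fun i _ => ?_
          rw [Finset.sum_comm]
          exact Finset.sum_congr rfl fun j _ => Finset.sum_congr rfl fun B _ => by ring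
      _ ≤ _ := Finset.sum_le_sum fun j _ => mul_le_mul_of_nonneg_right (hxs j) (hp j)
  have hsum : ∑ i, α i ≤
      ∑ i, ∑ B ∈ kBundles G k, (c i B - ∑ j, (B j : ℝ) * p j) * x i B := by
    simp only [sub_mul, Finset.sum_sub_distrib]
    linarith
  exact ((Finset.sum_eq_sum_iff_of_le fun i _ => hle i).1
    (le_antisymm (Finset.sum_le_sum fun i _ => hle i) hsum) i (Finset.mem_univ i)).ge

theorem stmt2 {N G : Type*} [Fintype N] [Fintype G] [Nonempty N] [Nonempty G]
    (k : ℕ) (hk : 1 ≤ k)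
    (u : N → (G → ℕ) → ℝ) (hu : ∀ i, ∀ B ∈ kBundles G k, 0 ≤ u i B)
    (δw : ℝ) (hδ0 : 0 ≤ δw) (hδ1 : δw < 1)
    (w : N → (G → ℕ) → ℝ)
    (hw : ∀ i, ∀ B ∈ kBundles G k, 1 - δw ≤ w i B ∧ w i B ≤ 1 + δw)
    (stil : G → ℝ)
    (M : N → ℝ)
    (hM : ∀ i, IsGreatest {v : ℝ | ∃ B ∈ kBundles G k, u i B = v} (M i))
    (xstar : N → (G → ℕ) → ℝ)
    (hxstar : LIPOptimal k (fun i B => w i B * u i B) stil xstar)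
    (αstar : N → ℝ) (pstar : G → ℝ)
    (hdual : DualOptimal k (fun i B => w i B * u i B) stil αstar pstar) :
    ∀ i i' : N,
      ∑ B ∈ kBundles G k, (u i B - ∑ j, (B j : ℝ) * pstar j) * xstar i B ≥
        ∑ B ∈ kBundles G k, (u i B - ∑ j, (B j : ℝ) * pstar j) * xstar i' B
          - 2 * δw * M i := by
  intro i i'
  obtain ⟨hx0, hx1, -⟩ := hxstar.1
  obtain ⟨hα, -, hc⟩ := hdual.1
  have hdev : ∀ B ∈ kBundles G k, |w i B * u i B - u i B| ≤ δw * M i := by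
    intro B hB
    have h1 : |w i B - 1| ≤ δw := abs_le.2 ⟨by linarith [(hw i B hB).1], by linarith [(hw i B hB).2]⟩
    calc |w i B * u i B - u i B| = |w i B - 1| * u i B := by
          rw [← sub_one_mul, abs_mul, abs_of_nonneg (hu i B hB)]
      _ ≤ δw * M i := mul_le_mul h1 ((hM i).2 ⟨B, hB, rfl⟩) (hu i B hB) hδ0
  have hM0 : 0 ≤ M i := by
    obtain ⟨B, hB, h⟩ := (hM i).1
    exact h ▸ hu i B hB
  have hδM : 0 ≤ δw * M i := mul_nonneg hδ0 hM0
  have hown : αstar i - δw * M i ≤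
      ∑ B ∈ kBundles G k, (u i B - ∑ j, (B j : ℝ) * pstar j) * xstar i B := by
    have h1 := le_sum_surplus_of_optimal hxstar hdual i
    have h2 : ∑ B ∈ kBundles G k, (w i B * u i B - ∑ j, (B j : ℝ) * pstar j) * xstar i B ≤
        ∑ B ∈ kBundles G k, ((u i B - ∑ j, (B j : ℝ) * pstar j) * xstar i B +
          δw * M i * xstar i B) := Finset.sum_le_sum fun B hB => by
      rw [← add_mul]
      exact mul_le_mul_of_nonneg_right (by linarith [(abs_le.1 (hdev B hB)).2]) (hx0 i B hB)
    rw [Finset.sum_add_distrib, ← Finset.mul_sum] at h2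
    linarith [mul_le_of_le_one_right hδM (hx1 i)]
  have hother : ∑ B ∈ kBundles G k, (u i B - ∑ j, (B j : ℝ) * pstar j) * xstar i' B ≤
      αstar i + δw * M i :=
    calc
      _ ≤ ∑ B ∈ kBundles G k, (αstar i + δw * M i) * xstar i' B := Finset.sum_le_sum fun B hB =>
          mul_le_mul_of_nonneg_right
            (by linarith [(abs_le.1 (hdev B hB)).1, hc i B hB]) (hx0 i' B hB)
      _ = (αstar i + δw * M i) * ∑ B ∈ kBundles G k, xstar i' B := by rw [Finset.mul_sum]
      _ ≤ _ := mul_le_of_le_one_right (add_nonneg (hα i) hδM) (hx1 i')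
  linarith
end

section
/- Let N and G be finite nonempty sets, let k ≥ 1 be an integer, and let 𝓑 be the set of k-bundles. Let u : N → 𝓑 → ℝ with u_i(B) ≥ 0, let 0 ≤ δ_w < 1, let w : N → 𝓑 → ℝ with 1 − δ_w ≤ w_i(B) ≤ 1 + δ_w, let s̃, s : G → ℝ with s̃_j ≤ s_j, and set M_i = max_{B∈𝓑} u_i(B). Let x* be an optimal solution of (LIP) with rewards c_i(B) = w_i(B)u_i(B) and supplies s̃, and let (α*, p*) be an optimal solution of the dual of this (LIP). Let x̄ : N → 𝓑 → ℝ with x̄ ≥ 0 satisfy: x̄_i(B) = 0 whenever x*_i(B) = 0; Σ_{B∈𝓑} x̄_i(B) = 1 for every i with Σ_{B∈𝓑} x*_i(B) = 1; Σ_{B∈𝓑} x̄_i(B) ≤ 1 for every i; and Σ_{i,B} B_j x̄_i(B) ≤ s_j + k − 1 for every j. Then, with bundle prices P(B) = Σ_{j∈G} B_j p*_j, the allocation x̄ is approximately envy-free: for all i, k ∈ N, Σ_{B∈𝓑} (u_i(B) − P(B)) x̄_i(B) ≥ Σ_{B∈𝓑} (u_i(B) − P(B)) x̄_k(B) − 2δ_w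 M_i. -/
open Matrix in
/-- **Strong duality** for finite linear programs whose minimization problem is strictly feasible:
a lower bound of the minimization problem is attained by the maximization problem. -/
theorem exists_dual_certificate {R J : Type*} [Fintype R] [Fintype J]
    (A : Matrix R J ℝ) (c : R → ℝ) (b : J → ℝ) (v : ℝ)
    (hv : ∀ z : J → ℝ, 0 ≤ z → (∀ r, c r ≤ (A *ᵥ z) r) → v ≤ b ⬝ᵥ z)
    (hstrict : ∃ z : J → ℝ, 0 ≤ z ∧ ∀ r, c r < (A *ᵥ z) r) :
    ∃ x : R → ℝ, 0 ≤ x ∧ (∀ j, (x ᵥ* A) j ≤ b j) ∧ v ≤ x ⬝ᵥ c := by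
  classical
  let S : Set ((R → ℝ) × ℝ) :=
    {q | ∃ z : J → ℝ, 0 ≤ z ∧ (∀ r, q.1 r < (A *ᵥ z) r - c r) ∧ b ⬝ᵥ z - v < q.2}
  have hSopen : IsOpen S := by
    have : S = ⋃ z ∈ {z : J → ℝ | 0 ≤ z},
        ((⋂ r, {q : (R → ℝ) × ℝ | q.1 r < (A *ᵥ z) r - c r}) ∩ {q | b ⬝ᵥ z - v < q.2}) := by
      ext q
      simp only [S, Set.mem_ofPred_eq, Set.mem_iUnion, Set.mem_inter_iff, Set.mem_iInter,
        exists_prop]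
    rw [this]
    refine isOpen_biUnion fun z _ => IsOpen.inter (isOpen_iInter_of_finite fun r => ?_) ?_
    · exact isOpen_lt (by fun_prop) (by fun_prop)
    · exact isOpen_lt (by fun_prop) (by fun_prop)
  have hSconv : Convex ℝ S := by
    rintro q ⟨z, hz, hq, hq'⟩ q' ⟨z', hz', hr, hr'⟩ a a' ha ha' haa
    refine ⟨a • z + a' • z', by positivity, fun r => ?_, ?_⟩
    · simp only [mulVec_add, mulVec_smul, Prod.fst_add, Prod.smul_fst, Pi.add_apply,
        Pi.smul_apply, smul_eq_mul]
      have h1 := hq r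
      have h2 := hr r
      obtain rfl : a' = 1 - a := by linarith
      rcases ha.eq_or_lt with rfl | ha0
      · linarith
      · nlinarith [mul_lt_mul_of_pos_left h1 ha0, mul_le_mul_of_nonneg_left h2.le ha']
    · simp only [dotProduct_add, dotProduct_smul, Prod.snd_add, Prod.smul_snd, smul_eq_mul]
      obtain rfl : a' = 1 - a := by linarith
      rcases ha.eq_or_lt with rfl | ha0
      · linarith
      · nlinarith [mul_lt_mul_of_pos_left hq' ha0, mul_le_mul_of_nonneg_left hr'.le ha']
  have h0 : (0 : (R → ℝ) × ℝ) ∉ S := by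
    rintro ⟨z, hz, h1, h2⟩
    have := hv z hz fun r => by have := h1 r; simp at this; linarith
    simp at h2
    linarith
  obtain ⟨f, hf⟩ := geometric_hahn_banach_open_point hSconv hSopen h0
  simp only [map_zero] at hf
  set l : R → ℝ := fun r => f (Pi.single r 1, 0) with hl
  set μ : ℝ := f (0, 1) with hμ
  have hrep : ∀ y t, f (y, t) = l ⬝ᵥ y + t * μ := by
    intro y t
    have h1 : (y, t) = ∑ r, y r • ((Pi.single r 1, 0) : (R → ℝ) × ℝ) + t • ((0, 1) : (R → ℝ) × ℝ) := by
      ext r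
      · simp [Prod.fst_sum, Finset.sum_apply, Pi.single_apply]
      · simp [Prod.snd_sum]
    rw [h1, map_add, map_sum, map_smul]
    simp only [map_smul, smul_eq_mul, dotProduct, hl, hμ]
    congr 1
    exact Finset.sum_congr rfl fun r _ => mul_comm _ _
  obtain ⟨z₀, hz₀, hs⟩ := hstrict
  have hμneg : μ < 0 := by
    have := hf (0, |b ⬝ᵥ z₀ - v| + 1) ⟨z₀, hz₀, fun r => by simpa using hs r,
      by have := le_abs_self (b ⬝ᵥ z₀ - v); dsimp only; linarith⟩
    rw [hrep] at this
    simp only [dotProduct_zero, zero_add] at this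
    have h2 := abs_nonneg (b ⬝ᵥ z₀ - v)
    by_contra! h
    nlinarith
  have hlnonneg : ∀ r, 0 ≤ l r := by
    intro r
    by_contra! h
    have key : ∀ K : ℝ, 0 ≤ K → -K * l r + (b ⬝ᵥ z₀ - v + 1) * μ < 0 := by
      intro K hK
      have := hf (Pi.single r (-K), b ⬝ᵥ z₀ - v + 1) ⟨z₀, hz₀, fun r' => ?_, by dsimp only; linarith⟩
      · rw [hrep] at this
        simp only [dotProduct_single] at this
        linarith
      · have h1 := hs r'
        rcases eq_or_ne r' r with rfl | hne
        · simp only [Pi.single_eq_same]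
          linarith
        · simp only [Pi.single_eq_of_ne hne]
          linarith
    have h1 := key (|(b ⬝ᵥ z₀ - v + 1) * μ| / (-l r)) (by
      have : 0 < -l r := by linarith
      positivity)
    have h2 : -(|(b ⬝ᵥ z₀ - v + 1) * μ| / (-l r)) * l r = |(b ⬝ᵥ z₀ - v + 1) * μ| := by
      rw [div_neg, neg_neg, div_mul_cancel₀ _ h.ne]
    rw [h2] at h1
    linarith [neg_abs_le ((b ⬝ᵥ z₀ - v + 1) * μ)]
  have hclosed : ∀ z : J → ℝ, 0 ≤ z → l ⬝ᵥ (A *ᵥ z - c) + (b ⬝ᵥ z - v) * μ ≤ 0 := by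
    intro z hz
    have hcont : Filter.Tendsto (fun ε : ℝ => f (A *ᵥ z - c - fun _ => ε, b ⬝ᵥ z - v + ε))
        (nhdsWithin 0 (Set.Ioi 0)) (nhds (f (A *ᵥ z - c - fun _ => (0 : ℝ), b ⬝ᵥ z - v + 0))) :=
      ((by fun_prop : Continuous fun ε : ℝ =>
        f (A *ᵥ z - c - fun _ => ε, b ⬝ᵥ z - v + ε)).tendsto 0).mono_left nhdsWithin_le_nhds
    rw [← hrep]
    have h1 : (A *ᵥ z - c - fun _ => (0 : ℝ)) = A *ᵥ z - c := by ext; simp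
    rw [h1, add_zero] at hcont
    refine le_of_tendsto hcont ?_
    filter_upwards [self_mem_nhdsWithin] with ε hε
    have hε : 0 < ε := hε
    exact (hf _ ⟨z, hz, fun r => by simp [hε], by simp [hε]⟩).le
  have hm : 0 < -μ := by linarith
  refine ⟨fun r => l r / -μ, fun r => div_nonneg (hlnonneg r) hm.le, fun j => ?_, ?_⟩
  · have hx : (fun r => l r / -μ) = (-μ)⁻¹ • l := by
      ext r
      simp [div_eq_inv_mul]
    rw [hx, smul_vecMul, Pi.smul_apply, smul_eq_mul, inv_mul_le_iff₀ hm]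
    by_contra! h
    set d := (l ᵥ* A) j - -μ * b j with hd
    have hdpos : 0 < d := by linarith
    have key : ∀ K : ℝ, 0 ≤ K → K * d - l ⬝ᵥ c - v * μ ≤ 0 := by
      intro K hK
      have := hclosed (Pi.single j K) (by simpa using hK)
      rw [dotProduct_sub, dotProduct_mulVec, dotProduct_single, dotProduct_single] at this
      rw [hd]
      linarith
    have h1 := key ((|l ⬝ᵥ c + v * μ| + 1) / d) (by positivity)
    rw [div_mul_cancel₀ _ hdpos.ne'] at h1
    linarith [le_abs_self (l ⬝ᵥ c + v * μ)]
  · have hx : (fun r => l r / -μ) = (-μ)⁻¹ • l := by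
      ext r
      simp [div_eq_inv_mul]
    have := hclosed 0 le_rfl
    rw [hx, smul_dotProduct, smul_eq_mul, le_inv_mul_iff₀ hm]
    simp only [mulVec_zero, zero_sub, dotProduct_neg, dotProduct_zero] at this
    linarith

/-- Strong duality for (LIP): the optimal value of the dual is at most that of the primal. -/
theorem DualOptimal.value_le {N G : Type*} [Fintype N] [Fintype G] {k : ℕ}
    {c : N → (G → ℕ) → ℝ} {s : G → ℝ} {x : N → (G → ℕ) → ℝ} {α : N → ℝ} {p : G → ℝ}
    (hd : DualOptimal k c s α p) (hx : LIPOptimal k c s x) :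
    ∑ i, α i + ∑ j, s j * p j ≤ ∑ i, ∑ B ∈ kBundles G k, c i B * x i B := by
  classical
  let A : Matrix (N × kBundles G k) (N ⊕ G) ℝ := fun r =>
    Sum.elim (fun i => if r.1 = i then 1 else 0) (fun j => (r.2.1 j : ℝ))
  have hA : ∀ z r, (A.mulVec z) r = z (.inl r.1) + ∑ j, (r.2.1 j : ℝ) * z (.inr j) := by
    intro z r
    simp [A, Matrix.mulVec, dotProduct, Fintype.sum_sum_type]
  obtain ⟨X, hX0, hXA, hXc⟩ := exists_dual_certificate A (fun r => c r.1 r.2)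
    (Sum.elim (fun _ => 1) s) (∑ i, α i + ∑ j, s j * p j)
    (fun z hz h => by
      have := hd.2 (fun i => z (.inl i)) (fun j => z (.inr j))
        ⟨fun i => hz _, fun j => hz _, fun i B hB => by
          have := h (i, ⟨B, hB⟩)
          rwa [hA] at this⟩
      simpa [dotProduct, Fintype.sum_sum_type] using this)
    ⟨Sum.elim (fun _ => ∑ r : N × kBundles G k, |c r.1 r.2| + 1) 0, by
      rintro (i | j)
      · simp only [Sum.elim_inl, Pi.zero_apply]
        positivity
      · simp, fun r => by
      rw [hA]
      have h1 := Finset.single_le_sum (f := fun r : N × kBundles G k => |c r.1 r.2|)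
        (fun r _ => abs_nonneg _) (Finset.mem_univ r)
      have h2 := le_abs_self (c r.1 r.2)
      simp only [Sum.elim_inl, Sum.elim_inr, Pi.zero_apply, mul_zero, Finset.sum_const_zero] at h1 ⊢
      linarith⟩
  let y : N → (G → ℕ) → ℝ := fun i B => if h : B ∈ kBundles G k then X (i, ⟨B, h⟩) else 0
  have hy : ∀ (g : (G → ℕ) → ℝ) i,
      ∑ B ∈ kBundles G k, g B * y i B = ∑ B : kBundles G k, g B * X (i, B) := by
    intro g i
    rw [← Finset.sum_coe_sort]
    exact Finset.sum_congr rfl fun B _ => by simp [y]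
  have hfeas : LIPFeasible k s y := by
    refine ⟨fun i B hB => ?_, fun i => ?_, fun j => ?_⟩
    · simpa [y, hB] using hX0 (i, ⟨B, hB⟩)
    · have := hXA (.inl i)
      have h1 := hy (fun _ => 1) i
      simp only [one_mul] at h1
      rw [h1]
      simpa [A, Matrix.vecMul, dotProduct, Fintype.sum_prod_type, Finset.sum_comm (γ := N)]
        using this
    · have := hXA (.inr j)
      simp only [hy (fun B => (B j : ℝ))]
      simpa [A, Matrix.vecMul, dotProduct, Fintype.sum_prod_type, mul_comm] using this
  refine hXc.trans (le_trans (le_of_eq ?_) (hx.2 y hfeas))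
  simp only [hy, dotProduct, Fintype.sum_prod_type]
  exact Finset.sum_congr rfl fun i _ => Finset.sum_congr rfl fun B _ => mul_comm _ _

/-- Complementary slackness for (LIP). -/
theorem DualOptimal.complementary_slackness {N G : Type*} [Fintype N] [Fintype G] {k : ℕ}
    {c : N → (G → ℕ) → ℝ} {s : G → ℝ} {x : N → (G → ℕ) → ℝ} {α : N → ℝ} {p : G → ℝ}
    (hd : DualOptimal k c s α p) (hx : LIPOptimal k c s x) :
    (∀ i, α i ≠ 0 → ∑ B ∈ kBundles G k, x i B = 1) ∧
    ∀ i, ∀ B ∈ kBundles G k, x i B ≠ 0 → c i B = α i + ∑ j, (B j : ℝ) * p j := by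
  have hval := hd.value_le hx
  obtain ⟨⟨hα, hp, hc⟩, -⟩ := hd
  obtain ⟨⟨hx0, hx1, hxs⟩, -⟩ := hx
  have hrow : ∀ i, ∀ B ∈ kBundles G k,
      0 ≤ (α i + ∑ j, (B j : ℝ) * p j - c i B) * x i B := fun i B hB =>
    mul_nonneg (by linarith [hc i B hB]) (hx0 i B hB)
  have hdem : ∀ i, 0 ≤ α i * (1 - ∑ B ∈ kBundles G k, x i B) := fun i =>
    mul_nonneg (hα i) (by linarith [hx1 i])
  have hsup : 0 ≤ ∑ j, p j * (s j - ∑ i, ∑ B ∈ kBundles G k, (B j : ℝ) * x i B) :=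
    Finset.sum_nonneg fun j _ => mul_nonneg (hp j) (by linarith [hxs j])
  have hP : ∑ j, p j * ∑ i, ∑ B ∈ kBundles G k, (B j : ℝ) * x i B
      = ∑ i, ∑ B ∈ kBundles G k, (∑ j, (B j : ℝ) * p j) * x i B := by
    simp only [Finset.mul_sum, Finset.sum_mul]
    rw [Finset.sum_comm]
    refine Finset.sum_congr rfl fun i _ => ?_
    rw [Finset.sum_comm]
    exact Finset.sum_congr rfl fun B _ => Finset.sum_congr rfl fun j _ => by ring
  have hsp : ∑ j, s j * p j = ∑ j, p j * s j := Finset.sum_congr rfl fun j _ => mul_comm _ _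
  have hgap : ∑ i, ∑ B ∈ kBundles G k, (α i + ∑ j, (B j : ℝ) * p j - c i B) * x i B
      + ∑ i, α i * (1 - ∑ B ∈ kBundles G k, x i B) ≤ 0 := by
    simp only [mul_sub, mul_one, Finset.sum_sub_distrib, sub_mul, add_mul,
      Finset.sum_add_distrib, ← Finset.mul_sum] at hsup ⊢
    linarith
  have hrows : 0 ≤ ∑ i, ∑ B ∈ kBundles G k, (α i + ∑ j, (B j : ℝ) * p j - c i B) * x i B :=
    Finset.sum_nonneg fun i _ => Finset.sum_nonneg (hrow i)
  have hdems : 0 ≤ ∑ i, α i * (1 - ∑ B ∈ kBundles G k, x i B) :=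
    Finset.sum_nonneg fun i _ => hdem i
  refine ⟨fun i hi => ?_, fun i B hB hxB => ?_⟩
  · have h := (Finset.sum_eq_zero_iff_of_nonneg fun i _ => hdem i).1
      (by linarith) i (Finset.mem_univ i)
    have := (mul_eq_zero.1 h).resolve_left hi
    linarith
  · have h := (Finset.sum_eq_zero_iff_of_nonneg fun i _ => Finset.sum_nonneg (hrow i)).1
      (by linarith) i (Finset.mem_univ i)
    have h' := (Finset.sum_eq_zero_iff_of_nonneg (hrow i)).1 h B hB
    have := (mul_eq_zero.1 h').resolve_right hxB
    linarith

theorem stmt3 {N G : Type*} [Fintype N] [Fintype G] [Nonempty N] [Nonempty G]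
    (k : ℕ) (hk : 1 ≤ k)
    (u : N → (G → ℕ) → ℝ) (hu : ∀ i, ∀ B ∈ kBundles G k, 0 ≤ u i B)
    (δw : ℝ) (hδ0 : 0 ≤ δw) (hδ1 : δw < 1)
    (w : N → (G → ℕ) → ℝ)
    (hw : ∀ i, ∀ B ∈ kBundles G k, 1 - δw ≤ w i B ∧ w i B ≤ 1 + δw)
    (stil s : G → ℝ) (hss : ∀ j, stil j ≤ s j)
    (M : N → ℝ)
    (hM : ∀ i, IsGreatest {v : ℝ | ∃ B ∈ kBundles G k, u i B = v} (M i))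
    (xstar : N → (G → ℕ) → ℝ)
    (hxstar : LIPOptimal k (fun i B => w i B * u i B) stil xstar)
    (αstar : N → ℝ) (pstar : G → ℝ)
    (hdual : DualOptimal k (fun i B => w i B * u i B) stil αstar pstar)
    (xbar : N → (G → ℕ) → ℝ)
    (hpos : ∀ i, ∀ B ∈ kBundles G k, 0 ≤ xbar i B)
    (hzero : ∀ i, ∀ B ∈ kBundles G k, xstar i B = 0 → xbar i B = 0)
    (hone : ∀ i, ∑ B ∈ kBundles G k, xstar i B = 1 → ∑ B ∈ kBundles G k, xbar i B = 1)
    (hdem : ∀ i, ∑ B ∈ kBundles G k, xbar i B ≤ 1)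
    (hsup : ∀ j, ∑ i, ∑ B ∈ kBundles G k, (B j : ℝ) * xbar i B ≤ s j + k - 1) :
    ∀ i i' : N,
      ∑ B ∈ kBundles G k, (u i B - ∑ j, (B j : ℝ) * pstar j) * xbar i B ≥
        ∑ B ∈ kBundles G k, (u i B - ∑ j, (B j : ℝ) * pstar j) * xbar i' B
          - 2 * δw * M i := by
  intro i i'
  obtain ⟨hslackα, hslackx⟩ := hdual.complementary_slackness hxstar
  obtain ⟨⟨hα, -, hc⟩, -⟩ := hdual
  have huM : ∀ B ∈ kBundles G k, u i B ≤ M i := fun B hB => (hM i).2 ⟨B, hB, rfl⟩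
  have hM0 : 0 ≤ M i := by
    obtain ⟨B, hB, h⟩ := (hM i).1
    exact h ▸ hu i B hB
  have herr : ∀ B ∈ kBundles G k, |(1 - w i B) * u i B| ≤ δw * M i := by
    intro B hB
    rw [abs_mul, abs_of_nonneg (hu i B hB)]
    have h1 : |1 - w i B| ≤ δw := abs_le.2 ⟨by linarith [hw i B hB], by linarith [hw i B hB]⟩
    exact mul_le_mul h1 (huM B hB) (hu i B hB) hδ0
  have hδM : 0 ≤ δw * M i := mul_nonneg hδ0 hM0
  have hown : αstar i - δw * M i ≤
      ∑ B ∈ kBundles G k, (u i B - ∑ j, (B j : ℝ) * pstar j) * xbar i B := by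
    have hterm : ∑ B ∈ kBundles G k, (αstar i - δw * M i) * xbar i B ≤
        ∑ B ∈ kBundles G k, (u i B - ∑ j, (B j : ℝ) * pstar j) * xbar i B := by
      refine Finset.sum_le_sum fun B hB => ?_
      by_cases hx : xstar i B = 0
      · simp [hzero i B hB hx]
      · refine mul_le_mul_of_nonneg_right ?_ (hpos i B hB)
        have := hslackx i B hB hx
        linarith [(abs_le.1 (herr B hB)).1]
    rw [← Finset.mul_sum] at hterm
    refine le_trans ?_ hterm
    by_cases h0 : αstar i = 0
    · rw [h0]
      nlinarith [hdem i]
    · rw [hone i (hslackα i h0), mul_one]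
  have hother : ∑ B ∈ kBundles G k, (u i B - ∑ j, (B j : ℝ) * pstar j) * xbar i' B ≤
      αstar i + δw * M i := by
    calc _ ≤ ∑ B ∈ kBundles G k, (αstar i + δw * M i) * xbar i' B := by
          refine Finset.sum_le_sum fun B hB => mul_le_mul_of_nonneg_right ?_ (hpos i' B hB)
          linarith [hc i B hB, (abs_le.1 (herr B hB)).2]
      _ ≤ αstar i + δw * M i := by
          rw [← Finset.mul_sum]
          exact mul_le_of_le_one_right (add_nonneg (hα i) hδM) (hdem i')
  linarith
end

section
/- Let N and G be finite nonempty sets, let k ≥ 1 be an integer, and let 𝓑 be the set of k-bundles. For each i ∈ N let 𝓑_i ⊆ 𝓑 be nonempty, let N₁ ⊆ N, let G' ⊆ G, and let s̃ : G' → ℝ. Let P be the polytope of all x : N → 𝓑 → ℝ with x_i(B) ≥ 0, x_i(B) = 0 for B ∉ 𝓑_i, Σ_{B∈𝓑_i} x_i(B) = 1 for i ∈ N₁, Σ_{B∈𝓑_i} x_i(B) ≤ 1 for i ∈ N∖N₁, and Σ_{i∈N} Σ_{B∈𝓑_i} B_j x_i(B) ≤ s̃_j for j ∈ G'. If z is an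 extreme point of P with 0 < z_i(B) < 1 for every i ∈ N and B ∈ 𝓑_i, then there exists j ∈ G' such that Σ_{i∈N} Σ_{B∈𝓑_i} B_j ≤ ⌈s̃_j⌉ + k − 1. -/
open Filter Topology in
/-- A weak inequality survives a small perturbation in a direction that vanishes where it is
tight. -/
theorem eventually_add_mul_le {a b c : ℝ} (hac : a ≤ c) (hb : a = c → b = 0) :
    ∀ᶠ t in 𝓝 (0 : ℝ), a + t * b ≤ c := by
  rcases hac.eq_or_lt with h | h
  · exact Eventually.of_forall fun t => by simp [hb h, h]
  · have hc : Tendsto (fun t : ℝ => a + t * b) (𝓝 0) (𝓝 (a + 0 * b)) :=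
      Continuous.tendsto (by fun_prop) 0
    rw [zero_mul, add_zero] at hc
    exact (hc.eventually_lt_const h).mono fun _ => le_of_lt

open Filter Topology in
/-- An extreme point admits no nonzero direction along which every small move stays in the set. -/
theorem eq_zero_of_mem_extremePoints_of_eventually {V : Type*} [AddCommGroup V] [Module ℝ V]
    {P : Set V} {z d : V} (hz : z ∈ Set.extremePoints ℝ P)
    (hd : ∀ᶠ t in 𝓝 (0 : ℝ), z + t • d ∈ P) : d = 0 := by
  obtain ⟨ε, hε, h⟩ := Metric.eventually_nhds_iff.1 hd
  have h₁ : z + (ε / 2) • d ∈ P := h (by simp [abs_of_pos hε, hε])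
  have h₂ : z + (-(ε / 2)) • d ∈ P := h (by simp [abs_of_pos hε, hε])
  have hseg : z ∈ openSegment ℝ (z + (ε / 2) • d) (z + (-(ε / 2)) • d) :=
    ⟨1 / 2, 1 / 2, by norm_num, by norm_num, by norm_num, by module⟩
  have := hz.2 h₁ h₂ hseg
  simpa [hε.ne'] using this

/-- Row vectors with trivial common kernel contain a linearly independent subfamily of full
cardinality. -/
theorem exists_finset_linearIndepOn_card_eq {ι E : Type*} [Finite ι] [Fintype E]
    (v : ι → E → ℝ) (T : Set ι)
    (hT : ∀ d : E → ℝ, (∀ r ∈ T, ∑ e, v r e * d e = 0) → d = 0) :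
    ∃ S : Finset ι, ↑S ⊆ T ∧ S.card = Fintype.card E ∧ LinearIndepOn ℝ v (S : Set ι) := by
  classical
  obtain ⟨b, hbT, -, hspan, hb⟩ :=
    exists_linearIndepOn_extension (linearIndepOn_empty ℝ v) (Set.empty_subset T)
  lift b to Finset ι using b.toFinite
  refine ⟨b, hbT, ?_, hb⟩
  have htop : Submodule.span ℝ (Set.range fun r : (b : Set ι) => v r) = ⊤ := by
    rw [← Set.image_eq_range]
    by_contra hne
    obtain ⟨f, hf, hle⟩ := Submodule.exists_le_ker_of_lt_top _ (lt_top_iff_ne_top.2 hne)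
    have hsum : ∀ x : E → ℝ, f x = ∑ e, x e * f (Pi.single e 1) := fun x => by
      rw [LinearMap.pi_apply_eq_sum_univ f x]
      refine Finset.sum_congr rfl fun e _ => ?_
      rw [smul_eq_mul]
      congr 2
      funext e'
      simp [Pi.single_apply, eq_comm]
    have h0 := hT (fun e => f (Pi.single e 1)) fun r hr => by
      rw [← hsum]
      exact hle (hspan ⟨r, hr, rfl⟩)
    refine hf (LinearMap.ext fun x => ?_)
    rw [hsum]
    exact Finset.sum_eq_zero fun e _ => by simp [congrFun h0 e]
  have := Module.finrank_eq_card_basis (Module.Basis.mk hb htop.ge)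
  simpa using this.symm

/-- The coefficient rows of the agent constraints and of the good constraints, with one column
per pair of an agent and an admissible bundle. -/
noncomputable def constraintRow {N G : Type*} (𝓑i : N → Finset (G → ℕ)) :
    N ⊕ G → (Σ i, 𝓑i i) → ℝ :=
  open Classical in Sum.elim (fun i e => if e.1 = i then 1 else 0) (fun j e => (e.2.1 j : ℝ))

theorem sum_sigma_finset {N α M : Type*} [Fintype N] [AddCommMonoid M] (s : N → Finset α)
    (f : N → α → M) : ∑ e : Σ i, s i, f e.1 e.2 = ∑ i, ∑ b ∈ s i, f i b := by
  rw [Fintype.sum_sigma]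
  exact Finset.sum_congr rfl fun i _ => Finset.sum_coe_sort (s i) (f i)

theorem sum_constraintRow_inl {N G : Type*} [Fintype N] (𝓑i : N → Finset (G → ℕ))
    (f : N → (G → ℕ) → ℝ) (i : N) :
    ∑ e : Σ i, 𝓑i i, constraintRow 𝓑i (.inl i) e * f e.1 e.2 = ∑ B ∈ 𝓑i i, f i B := by
  classical
  have := sum_sigma_finset 𝓑i fun i' B => (if i' = i then 1 else 0) * f i' B
  simp only [constraintRow, Sum.elim_inl]
  convert this using 1
  simp

theorem sum_constraintRow_inr {N G : Type*} [Fintype N] (𝓑i : N → Finset (G → ℕ))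
    (f : N → (G → ℕ) → ℝ) (j : G) :
    ∑ e : Σ i, 𝓑i i, constraintRow 𝓑i (.inr j) e * f e.1 e.2 =
      ∑ i, ∑ B ∈ 𝓑i i, (B j : ℝ) * f i B :=
  sum_sigma_finset 𝓑i fun i B => (B j : ℝ) * f i B

/-- The token-counting argument: as many tight constraints as columns, each good constraint
carrying at least `k` tokens, force a linear relation between the constraint rows. -/
theorem not_linearIndepOn_constraintRow {N G : Type*} [Fintype N] [Nonempty N] {k : ℕ}
    (hk : 1 ≤ k) (𝓑i : N → Finset (G → ℕ)) (h𝓑ne : ∀ i, (𝓑i i).Nonempty)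
    (z : N → (G → ℕ) → ℝ) (hz : ∀ i, ∀ B ∈ 𝓑i i, 0 < z i B ∧ z i B < 1)
    (S : Finset (N ⊕ G)) (hcard : S.card = Fintype.card (Σ i, 𝓑i i))
    (hsize : ∀ i, ∀ B ∈ 𝓑i i, ∑ j ∈ S.toRight, B j ≤ k)
    (hagent : ∀ i ∈ S.toLeft, ∑ B ∈ 𝓑i i, z i B = 1)
    (hgood : ∀ j ∈ S.toRight, (k : ℝ) ≤ ∑ i, ∑ B ∈ 𝓑i i, (B j : ℝ) * (1 - z i B)) :
    ¬ LinearIndepOn ℝ (constraintRow 𝓑i) (S : Set (N ⊕ G)) := by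
  classical
  intro hS
  have hk0 : (0 : ℝ) < k := by exact_mod_cast hk
  have hspos : ∀ i, 0 < ∑ B ∈ 𝓑i i, z i B := fun i =>
    Finset.sum_pos (fun B hB => (hz i B hB).1) (h𝓑ne i)
  have hterm : ∀ i, ∀ B ∈ 𝓑i i, 0 ≤ ((k : ℝ) - ∑ j ∈ S.toRight, (B j : ℝ)) * (1 - z i B) :=
    fun i B hB => mul_nonneg (sub_nonneg.2 (by exact_mod_cast hsize i B hB))
      (sub_nonneg.2 (hz i B hB).2.le)
  have hinner : ∀ i, 0 ≤ ∑ B ∈ 𝓑i i, ((k : ℝ) - ∑ j ∈ S.toRight, (B j : ℝ)) * (1 - z i B) :=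
    fun i => Finset.sum_nonneg (hterm i)
  have hexpand : ∑ i, ∑ B ∈ 𝓑i i, ((k : ℝ) - ∑ j ∈ S.toRight, (B j : ℝ)) * (1 - z i B) =
      k * (S.card - ∑ i, ∑ B ∈ 𝓑i i, z i B) -
        ∑ j ∈ S.toRight, ∑ i, ∑ B ∈ 𝓑i i, (B j : ℝ) * (1 - z i B) := by
    have hc : (S.card : ℝ) = ∑ i, ∑ B ∈ 𝓑i i, (1 : ℝ) := by
      rw [hcard]
      simp
    rw [hc, Finset.sum_comm, ← Finset.sum_sub_distrib, Finset.mul_sum, ← Finset.sum_sub_distrib]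
    refine Finset.sum_congr rfl fun i _ => ?_
    rw [Finset.sum_comm, ← Finset.sum_sub_distrib, Finset.mul_sum, ← Finset.sum_sub_distrib]
    refine Finset.sum_congr rfl fun B _ => ?_
    rw [← Finset.sum_mul]
    ring
  have hgoods : (k : ℝ) * S.toRight.card ≤
      ∑ j ∈ S.toRight, ∑ i, ∑ B ∈ 𝓑i i, (B j : ℝ) * (1 - z i B) := by
    simpa [mul_comm] using Finset.card_nsmul_le_sum _ _ _ hgood
  have hagents : ∑ i, ∑ B ∈ 𝓑i i, z i B =
      S.toLeft.card + ∑ i ∈ S.toLeftᶜ, ∑ B ∈ 𝓑i i, z i B := by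
    rw [← Finset.sum_add_sum_compl S.toLeft, Finset.sum_congr rfl hagent]
    simp
  have hsplit : (S.card : ℝ) = S.toLeft.card + S.toRight.card := by
    exact_mod_cast (Finset.card_toLeft_add_card_toRight (u := S)).symm
  have hrest : 0 ≤ ∑ i ∈ S.toLeftᶜ, ∑ B ∈ 𝓑i i, z i B :=
    Finset.sum_nonneg fun i _ => (hspos i).le
  have htotal : ∑ i, ∑ B ∈ 𝓑i i, ((k : ℝ) - ∑ j ∈ S.toRight, (B j : ℝ)) * (1 - z i B) ≤
      -(k * ∑ i ∈ S.toLeftᶜ, ∑ B ∈ 𝓑i i, z i B) := by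
    rw [hexpand, hagents, hsplit]
    linarith
  have htotal0 := Finset.sum_nonneg fun i (_ : i ∈ Finset.univ) => hinner i
  have hrest0 : ∑ i ∈ S.toLeftᶜ, ∑ B ∈ 𝓑i i, z i B = 0 :=
    le_antisymm (by nlinarith) hrest
  have hzero := le_antisymm (by simpa [hrest0] using htotal) htotal0
  have hleft : S.toLeft = Finset.univ := by
    refine Finset.eq_univ_iff_forall.2 fun i => ?_
    by_contra hi
    exact (hspos i).ne' ((Finset.sum_eq_zero_iff_of_nonneg fun i _ => (hspos i).le).1 hrest0 i
      (Finset.mem_compl.2 hi))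
  have hfull : ∀ i, ∀ B ∈ 𝓑i i, ∑ j ∈ S.toRight, (B j : ℝ) = k := fun i B hB => by
    have h₁ := (Finset.sum_eq_zero_iff_of_nonneg fun i _ => hinner i).1 hzero i (Finset.mem_univ i)
    have h₂ := (Finset.sum_eq_zero_iff_of_nonneg (hterm i)).1 h₁ B hB
    rcases mul_eq_zero.1 h₂ with h | h
    · linarith
    · linarith [(hz i B hB).2]
  have hrel : ∑ r ∈ S, Sum.elim (fun _ : N => -(k : ℝ)) (fun _ : G => 1) r •
      constraintRow 𝓑i r = 0 := by
    funext e
    rw [← Finset.toLeft_disjSum_toRight (u := S), Finset.sum_disjSum, hleft]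
    simp [constraintRow, hfull e.1 e.2.1 e.2.2]
  obtain ⟨i⟩ := ‹Nonempty N›
  have hi : Sum.inl i ∈ S := Finset.mem_toLeft.1 (hleft ▸ Finset.mem_univ i)
  have := linearIndepOn_finset_iff.1 hS _ hrel _ hi
  simp only [Sum.elim_inl] at this
  linarith

theorem sum_le_of_mem_kBundles {G : Type*} [Fintype G] {k : ℕ} {B : G → ℕ}
    (hB : B ∈ kBundles G k) : ∑ j, B j ≤ k := by
  classical
  simp only [kBundles, Finset.mem_filter] at hB
  exact hB.2.2

theorem stmt6 {N G : Type*} [Fintype N] [Fintype G] [Nonempty N] [Nonempty G]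
    (k : ℕ) (hk : 1 ≤ k)
    (𝓑i : N → Finset (G → ℕ))
    (h𝓑sub : ∀ i, 𝓑i i ⊆ kBundles G k)
    (h𝓑ne : ∀ i, (𝓑i i).Nonempty)
    (N₁ : Finset N) (G' : Finset G) (stil : G → ℝ)
    (P : Set (N → (G → ℕ) → ℝ))
    (hP : P = {x | (∀ i B, 0 ≤ x i B) ∧
      (∀ i, ∀ B, B ∉ 𝓑i i → x i B = 0) ∧
      (∀ i ∈ N₁, ∑ B ∈ 𝓑i i, x i B = 1) ∧
      (∀ i ∉ N₁, ∑ B ∈ 𝓑i i, x i B ≤ 1) ∧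
      (∀ j ∈ G', ∑ i, ∑ B ∈ 𝓑i i, (B j : ℝ) * x i B ≤ stil j)})
    (z : N → (G → ℕ) → ℝ)
    (hz : z ∈ Set.extremePoints ℝ P)
    (hfrac : ∀ i, ∀ B ∈ 𝓑i i, 0 < z i B ∧ z i B < 1) :
    ∃ j ∈ G', ∑ i, ∑ B ∈ 𝓑i i, (B j : ℝ) ≤ (⌈stil j⌉ : ℝ) + k - 1 := by
  classical
  by_contra! hcon
  obtain ⟨hz0, hzoff, hzeq, hzle, hzG⟩ : z ∈ {x | _} := hP ▸ hz.1
  let T : Set (N ⊕ G) := {r | Sum.elim (fun i => ∑ B ∈ 𝓑i i, z i B = 1)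
    (fun j => j ∈ G' ∧ ∑ i, ∑ B ∈ 𝓑i i, (B j : ℝ) * z i B = stil j) r}
  have hkernel : ∀ d : (Σ i, 𝓑i i) → ℝ,
      (∀ r ∈ T, ∑ e, constraintRow 𝓑i r e * d e = 0) → d = 0 := by
    intro d hd
    let D : N → (G → ℕ) → ℝ := fun i B => if h : B ∈ 𝓑i i then d ⟨i, B, h⟩ else 0
    have hdD : d = fun e => D e.1 e.2 := by
      funext e
      simp [D]
    have hDoff : ∀ i, ∀ B ∉ 𝓑i i, D i B = 0 := fun i B hB => dif_neg hB
    have hDN : ∀ i, ∑ B ∈ 𝓑i i, z i B = 1 → ∑ B ∈ 𝓑i i, D i B = 0 := fun i hi => by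
      rw [← sum_constraintRow_inl, ← hd (.inl i) hi, hdD]
    have hDG : ∀ j ∈ G', ∑ i, ∑ B ∈ 𝓑i i, (B j : ℝ) * z i B = stil j →
        ∑ i, ∑ B ∈ 𝓑i i, (B j : ℝ) * D i B = 0 := fun j hj hj' => by
      rw [← sum_constraintRow_inr, ← hd (.inr j) ⟨hj, hj'⟩, hdD]
    have hsumN : ∀ (t : ℝ) i, ∑ B ∈ 𝓑i i, (z + t • D) i B =
        ∑ B ∈ 𝓑i i, z i B + t * ∑ B ∈ 𝓑i i, D i B := fun t i => by
      simp [Finset.sum_add_distrib, Finset.mul_sum]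
    have hsumG : ∀ (t : ℝ) j, ∑ i, ∑ B ∈ 𝓑i i, (B j : ℝ) * (z + t • D) i B =
        ∑ i, ∑ B ∈ 𝓑i i, (B j : ℝ) * z i B + t * ∑ i, ∑ B ∈ 𝓑i i, (B j : ℝ) * D i B :=
      fun t j => by
        simp [Finset.sum_add_distrib, Finset.mul_sum, mul_add, mul_left_comm]
    have hD : D = 0 := by
      refine eq_zero_of_mem_extremePoints_of_eventually hz ?_
      have e₁ := Filter.eventually_all.2 fun i => (Filter.eventually_all_finset (𝓑i i)).2
        fun B hB => eventually_add_mul_le (a := -z i B) (b := -D i B) (c := 0)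
          (by linarith [(hfrac i B hB).1]) fun h => by linarith [(hfrac i B hB).1]
      have e₂ := Filter.eventually_all.2 fun i =>
        eventually_add_mul_le (a := ∑ B ∈ 𝓑i i, z i B) (c := 1)
          (if hi : i ∈ N₁ then (hzeq i hi).le else hzle i hi) (hDN i)
      have e₃ := (Filter.eventually_all_finset G').2 fun j hj =>
        eventually_add_mul_le (hzG j hj) (hDG j hj)
      filter_upwards [e₁, e₂, e₃] with t h₁ h₂ h₃
      rw [hP]
      refine ⟨fun i B => ?_, fun i B hB => ?_, fun i hi => ?_, fun i _ => ?_, fun j hj => ?_⟩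
      · by_cases hB : B ∈ 𝓑i i
        · have := h₁ i B hB
          simp only [Pi.add_apply, Pi.smul_apply, smul_eq_mul]
          linarith
        · simp [hzoff i B hB, hDoff i B hB]
      · simp [hzoff i B hB, hDoff i B hB]
      · rw [hsumN, hDN i (hzeq i hi), hzeq i hi, mul_zero, add_zero]
      · exact (hsumN t i).trans_le (h₂ i)
      · exact (hsumG t j).trans_le (h₃ j hj)
    rw [hdD, hD]
    rfl
  obtain ⟨S, hST, hcard, hS⟩ := exists_finset_linearIndepOn_card_eq _ T hkernel
  refine not_linearIndepOn_constraintRow hk 𝓑i h𝓑ne z hfrac S hcard (fun i B hB => ?_)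
    (fun i hi => hST (Finset.mem_toLeft.1 hi)) (fun j hj => ?_) hS
  · exact (Finset.sum_le_sum_of_subset (Finset.subset_univ _)).trans
      (sum_le_of_mem_kBundles (h𝓑sub i hB))
  · obtain ⟨hjG, htight⟩ : j ∈ G' ∧ _ := hST (Finset.mem_toRight.1 hj)
    have hint : (⌈stil j⌉ : ℝ) + k ≤ ∑ i, ∑ B ∈ 𝓑i i, (B j : ℝ) := by
      have h : ⌈stil j⌉ + k - 1 < ∑ i, ∑ B ∈ 𝓑i i, (B j : ℤ) := by
        exact_mod_cast hcon j hjG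
      exact_mod_cast Int.sub_one_lt_iff.1 h
    simp only [mul_sub, mul_one, Finset.sum_sub_distrib]
    rw [htight]
    linarith [Int.le_ceil (stil j)]
end

section
/- Let d ≥ 1, let f : ℝ^d → ℝ be continuous, let (R_n)_{n∈ℕ} be a sequence of nonempty compact subsets of ℝ^d such that ⋃_n R_n is bounded, and let R* be a nonempty compact subset of ℝ^d. Assume: (i) for every strictly increasing φ : ℕ → ℕ and every sequence (z_t) with z_t ∈ R_{φ(t)} for all t that converges to some z̃ ∈ ℝ^d, one has z̃ ∈ R*; and (ii) the optimal values converge: sup_{R_n} f → sup_{R*} f as n → ∞. Suppose f attains its supremum over R* at a unique point y*. Then every sequence (y_n) with y_n ∈ R_n and f(y_n) = sup_{R_n} f for all n converges to y*. -/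
open Filter

theorem IsMaxOn.csSup_image_eq {α : Type*} {f : α → ℝ} {s : Set α} {a : α}
    (h : IsMaxOn f s a) (ha : a ∈ s) : sSup (f '' s) = f a :=
  IsGreatest.csSup_eq ⟨Set.mem_image_of_mem f ha, by
    rintro _ ⟨x, hx, rfl⟩
    exact h hx⟩

theorem stmt10 (d : ℕ) (hd : 1 ≤ d)
    (f : EuclideanSpace ℝ (Fin d) → ℝ) (hf : Continuous f)
    (R : ℕ → Set (EuclideanSpace ℝ (Fin d)))
    (hRne : ∀ n, (R n).Nonempty) (hRc : ∀ n, IsCompact (R n))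
    (hbdd : Bornology.IsBounded (⋃ n, R n))
    (Rstar : Set (EuclideanSpace ℝ (Fin d)))
    (hsne : Rstar.Nonempty) (hsc : IsCompact Rstar)
    (hupper : ∀ φ : ℕ → ℕ, StrictMono φ →
      ∀ z : ℕ → EuclideanSpace ℝ (Fin d), (∀ t, z t ∈ R (φ t)) →
      ∀ ztil : EuclideanSpace ℝ (Fin d), Tendsto z atTop (nhds ztil) → ztil ∈ Rstar)
    (hvals : Tendsto (fun n => sSup (f '' R n)) atTop (nhds (sSup (f '' Rstar))))
    (ystar : EuclideanSpace ℝ (Fin d))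
    (hystar : ystar ∈ Rstar ∧ IsMaxOn f Rstar ystar)
    (huniq : ∀ y ∈ Rstar, IsMaxOn f Rstar y → y = ystar)
    (y : ℕ → EuclideanSpace ℝ (Fin d))
    (hy : ∀ n, y n ∈ R n) (hymax : ∀ n, IsMaxOn f (R n) (y n)) :
    Tendsto y atTop (nhds ystar) := by
  refine tendsto_of_subseq_tendsto fun ns hns => ?_
  obtain ⟨ψ, hψ, hnsψ⟩ := strictMono_subseq_of_tendsto_atTop hns
  obtain ⟨z, -, χ, hχ, hlim⟩ := tendsto_subseq_of_bounded hbdd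
    (x := y ∘ ns ∘ ψ) fun t => Set.mem_iUnion_of_mem _ (hy _)
  have hmono : StrictMono ((ns ∘ ψ) ∘ χ) := hnsψ.comp hχ
  have hz : z ∈ Rstar := hupper _ hmono _ (fun t => hy _) z hlim
  have hval : f z = f ystar := by
    rw [← hystar.2.csSup_image_eq hystar.1]
    refine tendsto_nhds_unique ((hf.tendsto z).comp hlim) ?_
    refine (hvals.comp hmono.tendsto_atTop).congr fun t => ?_
    exact (hymax _).csSup_image_eq (hy _)
  have hzmax : IsMaxOn f Rstar z := fun x hx => (hystar.2 hx).trans hval.ge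
  exact ⟨ψ ∘ χ, huniq z hz hzmax ▸ hlim⟩
end

section
/- Let Θ and G be finite nonempty sets, let k ≥ 1 be an integer, let 𝓑 be the set of k-bundles, let c : Θ → 𝓑 → ℝ be rewards, and let s̃ : G → ℝ with s̃_j ≥ 0 for all j. Consider the limiting program (LIP_∞): maximize Σ_{θ∈Θ} Σ_{B∈𝓑} c_θ(B) y_θ(B) over y : Θ → 𝓑 → ℝ with y ≥ 0, subject only to Σ_{θ∈Θ} Σ_{B∈𝓑} B_j y_θ(B) ≤ s̃_j for all j ∈ G; and for n : Θ → ℕ the program (LIP_n), which is (LIP_∞) with the additional demand constraints Σ_{B∈𝓑} y_θ(B) ≤ n_θ for each θ ∈ Θ. Suppose (LIP_∞) has a unique optimal solution y*. Then for every sequence (nᵗ)_{t∈ℕ} of functions Θ → ℕ with min_{θ∈Θ} nᵗ_θ → ∞ as t → ∞, and every sequence (yᵗ) with yᵗ an optimal solution of (LIP_{nᵗ}), the sequence yᵗ converges to y*. -/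
/-- Feasibility for the limiting program (LIP_∞): only supply constraints. -/
def LIPinfFeasible {Θ G : Type*} [Fintype Θ] [Fintype G] (k : ℕ) (stil : G → ℝ)
    (y : Θ → {B : G → ℕ // B ∈ kBundles G k} → ℝ) : Prop :=
  (∀ θ B, 0 ≤ y θ B) ∧
  ∀ j, ∑ θ, ∑ B : {B : G → ℕ // B ∈ kBundles G k}, (B.1 j : ℝ) * y θ B ≤ stil j

/-- Optimality for (LIP_∞). -/
def LIPinfOptimal {Θ G : Type*} [Fintype Θ] [Fintype G] (k : ℕ)
    (c : Θ → (G → ℕ) → ℝ) (stil : G → ℝ)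
    (y : Θ → {B : G → ℕ // B ∈ kBundles G k} → ℝ) : Prop :=
  LIPinfFeasible k stil y ∧
  ∀ y' : Θ → {B : G → ℕ // B ∈ kBundles G k} → ℝ, LIPinfFeasible k stil y' →
    ∑ θ, ∑ B : {B : G → ℕ // B ∈ kBundles G k}, c θ B.1 * y' θ B ≤
      ∑ θ, ∑ B : {B : G → ℕ // B ∈ kBundles G k}, c θ B.1 * y θ B

/-- Feasibility for (LIP_n): (LIP_∞) with the additional demand constraints. -/
def LIPnFeasible {Θ G : Type*} [Fintype Θ] [Fintype G] (k : ℕ) (stil : G → ℝ)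
    (n : Θ → ℕ) (y : Θ → {B : G → ℕ // B ∈ kBundles G k} → ℝ) : Prop :=
  LIPinfFeasible k stil y ∧
  ∀ θ, ∑ B : {B : G → ℕ // B ∈ kBundles G k}, y θ B ≤ (n θ : ℝ)

/-- Optimality for (LIP_n). -/
def LIPnOptimal {Θ G : Type*} [Fintype Θ] [Fintype G] (k : ℕ)
    (c : Θ → (G → ℕ) → ℝ) (stil : G → ℝ) (n : Θ → ℕ)
    (y : Θ → {B : G → ℕ // B ∈ kBundles G k} → ℝ) : Prop :=
  LIPnFeasible k stil n y ∧
  ∀ y' : Θ → {B : G → ℕ // B ∈ kBundles G k} → ℝ, LIPnFeasible k stil n y' →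
    ∑ θ, ∑ B : {B : G → ℕ // B ∈ kBundles G k}, c θ B.1 * y' θ B ≤
      ∑ θ, ∑ B : {B : G → ℕ // B ∈ kBundles G k}, c θ B.1 * y θ B

theorem stmt12 {Θ G : Type*} [Fintype Θ] [Fintype G] [Nonempty Θ] [Nonempty G]
    (k : ℕ) (hk : 1 ≤ k)
    (c : Θ → (G → ℕ) → ℝ) (stil : G → ℝ) (hs : ∀ j, 0 ≤ stil j)
    (ystar : Θ → {B : G → ℕ // B ∈ kBundles G k} → ℝ)
    (hopt : LIPinfOptimal k c stil ystar)
    (huniq : ∀ y, LIPinfOptimal k c stil y → y = ystar)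
    (nseq : ℕ → Θ → ℕ)
    (hn : ∀ M : ℕ, ∃ T : ℕ, ∀ t ≥ T, ∀ θ, M ≤ nseq t θ)
    (yt : ℕ → Θ → {B : G → ℕ // B ∈ kBundles G k} → ℝ)
    (hyt : ∀ t, LIPnOptimal k c stil (nseq t) (yt t)) :
    Filter.Tendsto yt Filter.atTop (nhds ystar) := by
  obtain ⟨M, hM⟩ : ∃ M : ℕ, ∀ θ, ∑ B, ystar θ B ≤ (M : ℝ) := by
    obtain ⟨r, hr⟩ := (Set.finite_range fun θ => ∑ B, ystar θ B).bddAbove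
    obtain ⟨M, hM⟩ := exists_nat_ge r
    exact ⟨M, fun θ => (hr ⟨θ, rfl⟩).trans hM⟩
  obtain ⟨T, hT⟩ := hn M
  refine tendsto_nhds_of_eventually_eq (Filter.eventually_atTop.2 ⟨T, fun t ht => ?_⟩)
  have hfeas : LIPnFeasible k stil (nseq t) ystar :=
    ⟨hopt.1, fun θ => (hM θ).trans (by exact_mod_cast hT t ht θ)⟩
  exact huniq _ ⟨(hyt t).1.1, fun y' hy' => (hopt.2 y' hy').trans ((hyt t).2 ystar hfeas)⟩
end
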